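/- arXiv:2212.13112 — 5 statements merged into one kernel-verified Lean document; each statement's English description precedes it below -/
import Mathlib

section
/- Let n and m be nonnegative integers with n ≥ 2 and m ≤ 2^{n−2}. If 𝓟 is a convex family of subsets of {2,…,n−1} with |𝓟| = m, and 𝓕 = {{1} ∪ P : P ∈ 𝓟} is regarded as a family of subsets of [n], then 𝓕 is convex and |𝓕↕| = 2·|𝓟↕| + m, where 𝓟↕ is taken with respect to the ground set {2,…,n−1} and 𝓕↕ with respect to the ground set [n]. Consequently Φ(n,m) ≤ 2·Φ(n−2,m) + m. -/
open Finset

/-- The ground set `[n] = {1, …, n}`. -/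
def groundSet (n : ℕ) : Finset ℕ := Finset.Icc 1 n

/-- The up-closure `𝓕↑` of a family `F` with respect to ground set `X`. -/
def upClo (X : Finset ℕ) (F : Finset (Finset ℕ)) : Finset (Finset ℕ) :=
  X.powerset.filter (fun S => ∃ A ∈ F, A ⊆ S)

/-- The down-closure `𝓕↓` of a family `F` with respect to ground set `X`. -/
def downClo (X : Finset ℕ) (F : Finset (Finset ℕ)) : Finset (Finset ℕ) :=
  X.powerset.filter (fun S => ∃ A ∈ F, S ⊆ A)

/-- `𝓕↕ = 𝓕↑ ∪ 𝓕↓` with respect to ground set `X`. -/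
def udClo (X : Finset ℕ) (F : Finset (Finset ℕ)) : Finset (Finset ℕ) :=
  upClo X F ∪ downClo X F

/-- `Φ(n,m)`: the minimum of `|𝓕↕|` over families `𝓕 ⊆ 2^[n]` with `|𝓕| = m`,
closures taken w.r.t. the ground set `[n]`. -/
noncomputable def Phi (n m : ℕ) : ℕ :=
  sInf {k | ∃ F : Finset (Finset ℕ),
    F ⊆ (groundSet n).powerset ∧ F.card = m ∧ (udClo (groundSet n) F).card = k}

/-- A family is convex (w.r.t. ground set `X`) if `𝓕↑ ∩ 𝓕↓ = 𝓕`. -/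
def IsConvex (X : Finset ℕ) (F : Finset (Finset ℕ)) : Prop :=
  upClo X F ∩ downClo X F = F

theorem mem_upClo {X S : Finset ℕ} {F : Finset (Finset ℕ)} :
    S ∈ upClo X F ↔ S ⊆ X ∧ ∃ A ∈ F, A ⊆ S := by
  simp [upClo]

theorem mem_downClo {X S : Finset ℕ} {F : Finset (Finset ℕ)} :
    S ∈ downClo X F ↔ S ⊆ X ∧ ∃ A ∈ F, S ⊆ A := by
  simp [downClo]

theorem isConvex_iff {X : Finset ℕ} {F : Finset (Finset ℕ)} :
    IsConvex X F ↔
      F ⊆ X.powerset ∧ ∀ A ∈ F, ∀ B ∈ F, ∀ S, A ⊆ S → S ⊆ B → S ∈ F := by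
  constructor
  · intro h
    have hsub : F ⊆ X.powerset := by
      intro S hS
      rw [← h] at hS
      exact mem_powerset.2 (mem_upClo.1 (mem_inter.1 hS).1).1
    refine ⟨hsub, fun A hA B hB S hAS hSB => ?_⟩
    have hSX : S ⊆ X := hSB.trans (mem_powerset.1 (hsub hB))
    rw [← h]
    exact mem_inter.2 ⟨mem_upClo.2 ⟨hSX, A, hA, hAS⟩, mem_downClo.2 ⟨hSX, B, hB, hSB⟩⟩
  · rintro ⟨hsub, h⟩
    ext S
    rw [mem_inter, mem_upClo, mem_downClo]
    constructor
    · rintro ⟨⟨-, A, hA, hAS⟩, -, B, hB, hSB⟩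
      exact h A hA B hB S hAS hSB
    · intro hS
      have hSX := mem_powerset.1 (hsub hS)
      exact ⟨⟨hSX, S, hS, Subset.rfl⟩, hSX, S, hS, Subset.rfl⟩

theorem udClo_mono {X : Finset ℕ} {F G : Finset (Finset ℕ)} (h : F ⊆ G) :
    udClo X F ⊆ udClo X G := by
  intro S
  simp only [udClo, mem_union, mem_upClo, mem_downClo]
  rintro (⟨hS, A, hA, hAS⟩ | ⟨hS, A, hA, hAS⟩)
  · exact Or.inl ⟨hS, A, h hA, hAS⟩
  · exact Or.inr ⟨hS, A, h hA, hAS⟩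

/-- The convex hull `𝓕↑ ∩ 𝓕↓` is convex. -/
theorem isConvex_upClo_inter_downClo (X : Finset ℕ) (F : Finset (Finset ℕ)) :
    IsConvex X (upClo X F ∩ downClo X F) := by
  rw [isConvex_iff]
  refine ⟨fun S hS => mem_powerset.2 (mem_upClo.1 (mem_inter.1 hS).1).1, ?_⟩
  intro A hA B hB S hAS hSB
  obtain ⟨-, A', hA', hAA⟩ := mem_upClo.1 (mem_inter.1 hA).1
  obtain ⟨hBX, B', hB', hBB⟩ := mem_downClo.1 (mem_inter.1 hB).2
  have hSX := hSB.trans hBX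
  exact mem_inter.2 ⟨mem_upClo.2 ⟨hSX, A', hA', hAA.trans hAS⟩,
    mem_downClo.2 ⟨hSX, B', hB', hSB.trans hBB⟩⟩

/-- Passing to the convex hull does not enlarge `𝓕↕`. -/
theorem udClo_upClo_inter_downClo_subset (X : Finset ℕ) (F : Finset (Finset ℕ)) :
    udClo X (upClo X F ∩ downClo X F) ⊆ udClo X F := by
  intro S hS
  simp only [udClo, mem_union, mem_upClo, mem_downClo, mem_inter] at hS ⊢
  rcases hS with ⟨hS, A, ⟨⟨-, B, hB, hBA⟩, -⟩, hAS⟩ | ⟨hS, A, ⟨-, -, B, hB, hAB⟩, hSA⟩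
  · exact Or.inl ⟨hS, B, hB, hBA.trans hAS⟩
  · exact Or.inr ⟨hS, B, hB, hSA.trans hAB⟩

/-- Deleting a maximal member of a convex family leaves a convex family. -/
theorem IsConvex.erase_maximal {X M : Finset ℕ} {C : Finset (Finset ℕ)} (hC : IsConvex X C)
    (hM : Maximal (· ∈ C) M) : IsConvex X (C.erase M) := by
  rw [isConvex_iff] at hC ⊢
  refine ⟨(erase_subset _ _).trans hC.1, fun A hA B hB S hAS hSB => ?_⟩
  have hBC := mem_of_mem_erase hB
  refine mem_erase.2 ⟨?_, hC.2 A (mem_of_mem_erase hA) B hBC S hAS hSB⟩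
  rintro rfl
  exact ne_of_mem_erase hB (hM.eq_of_ge hBC hSB)

/-- A convex family contains convex subfamilies of every smaller cardinality. -/
theorem IsConvex.exists_subset_card_eq {X : Finset ℕ} {C : Finset (Finset ℕ)}
    (hC : IsConvex X C) {m : ℕ} (hm : m ≤ C.card) :
    ∃ D ⊆ C, D.card = m ∧ IsConvex X D := by
  induction hk : C.card generalizing C with
  | zero => exact ⟨C, Subset.rfl, by omega, hC⟩
  | succ k ih =>
    rcases hm.eq_or_lt with h | h
    · exact ⟨C, Subset.rfl, h.symm, hC⟩
    · obtain ⟨M, hM⟩ := C.exists_maximal (card_pos.1 (by omega))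
      have hcard : (C.erase M).card = k := by rw [card_erase_of_mem hM.1]; omega
      obtain ⟨D, hD, hDm, hDC⟩ := ih (hC.erase_maximal hM) (by omega) hcard
      exact ⟨D, hD.trans (erase_subset _ _), hDm, hDC⟩

/-- Every family can be replaced by a convex one of the same size without enlarging `𝓕↕`. -/
theorem exists_isConvex_card_udClo_le {X : Finset ℕ} {F : Finset (Finset ℕ)}
    (hF : F ⊆ X.powerset) :
    ∃ G, IsConvex X G ∧ G.card = F.card ∧ (udClo X G).card ≤ (udClo X F).card := by
  have hFC : F ⊆ upClo X F ∩ downClo X F := by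
    intro S hS
    have hSX := mem_powerset.1 (hF hS)
    exact mem_inter.2 ⟨mem_upClo.2 ⟨hSX, S, hS, Subset.rfl⟩,
      mem_downClo.2 ⟨hSX, S, hS, Subset.rfl⟩⟩
  obtain ⟨G, hG, hcard, hconv⟩ :=
    (isConvex_upClo_inter_downClo X F).exists_subset_card_eq (card_le_card hFC)
  exact ⟨G, hconv, hcard,
    card_le_card ((udClo_mono hG).trans (udClo_upClo_inter_downClo_subset X F))⟩

theorem upClo_map (e : ℕ ↪ ℕ) (X : Finset ℕ) (F : Finset (Finset ℕ)) :
    upClo (X.map e) (F.map (mapEmbedding e).toEmbedding) =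
      (upClo X F).map (mapEmbedding e).toEmbedding := by
  ext S
  simp only [mem_upClo, mem_map, RelEmbedding.coe_toEmbedding, mapEmbedding_apply]
  constructor
  · rintro ⟨hS, _, ⟨A, hA, rfl⟩, hAS⟩
    obtain ⟨T, hT, rfl⟩ := subset_map_iff.1 hS
    exact ⟨T, ⟨hT, A, hA, map_subset_map.1 hAS⟩, rfl⟩
  · rintro ⟨T, ⟨hT, A, hA, hAT⟩, rfl⟩
    exact ⟨map_subset_map.2 hT, _, ⟨A, hA, rfl⟩, map_subset_map.2 hAT⟩

theorem downClo_map (e : ℕ ↪ ℕ) (X : Finset ℕ) (F : Finset (Finset ℕ)) :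
    downClo (X.map e) (F.map (mapEmbedding e).toEmbedding) =
      (downClo X F).map (mapEmbedding e).toEmbedding := by
  ext S
  simp only [mem_downClo, mem_map, RelEmbedding.coe_toEmbedding, mapEmbedding_apply]
  constructor
  · rintro ⟨hS, _, ⟨A, hA, rfl⟩, hAS⟩
    obtain ⟨T, hT, rfl⟩ := subset_map_iff.1 hS
    exact ⟨T, ⟨hT, A, hA, map_subset_map.1 hAS⟩, rfl⟩
  · rintro ⟨T, ⟨hT, A, hA, hAT⟩, rfl⟩
    exact ⟨map_subset_map.2 hT, _, ⟨A, hA, rfl⟩, map_subset_map.2 hAT⟩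

theorem udClo_map (e : ℕ ↪ ℕ) (X : Finset ℕ) (F : Finset (Finset ℕ)) :
    udClo (X.map e) (F.map (mapEmbedding e).toEmbedding) =
      (udClo X F).map (mapEmbedding e).toEmbedding := by
  simp only [udClo, upClo_map, downClo_map, map_union]

theorem IsConvex.map (e : ℕ ↪ ℕ) {X : Finset ℕ} {F : Finset (Finset ℕ)} (h : IsConvex X F) :
    IsConvex (X.map e) (F.map (mapEmbedding e).toEmbedding) := by
  unfold IsConvex at h ⊢
  rw [upClo_map, downClo_map, ← map_inter, h]

theorem card_image_insert {a : ℕ} {G : Finset (Finset ℕ)} (h : ∀ A ∈ G, a ∉ A) :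
    (G.image (insert a)).card = G.card := by
  refine card_image_of_injOn fun A hA B hB hAB => ?_
  rw [← erase_insert (h A hA), ← erase_insert (h B hB)]
  exact congrArg (fun S => S.erase a) hAB

/-- Adjoining a new point to every member of a convex family keeps it convex in any
larger ground set. -/
theorem IsConvex.image_insert {X Y : Finset ℕ} {a : ℕ} {P : Finset (Finset ℕ)}
    (hP : IsConvex Y P) (ha : a ∉ Y) (hX : insert a Y ⊆ X) :
    IsConvex X (P.image (insert a)) := by
  rw [isConvex_iff] at hP ⊢
  have hY : ∀ A ∈ P, A ⊆ Y := fun A hA => mem_powerset.1 (hP.1 hA)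
  constructor
  · intro S hS
    obtain ⟨A, hA, rfl⟩ := mem_image.1 hS
    exact mem_powerset.2 ((insert_subset_insert a (hY A hA)).trans hX)
  · intro A' hA' B' hB' S hAS hSB
    obtain ⟨A, hA, rfl⟩ := mem_image.1 hA'
    obtain ⟨B, hB, rfl⟩ := mem_image.1 hB'
    refine mem_image.2 ⟨S.erase a, hP.2 A hA B hB _ ?_ (subset_insert_iff.1 hSB),
      insert_erase (hAS (mem_insert_self a A))⟩
    rw [subset_erase]
    exact ⟨(subset_insert a A).trans hAS, fun h => ha (hY A hA h)⟩

theorem downClo_image_insert {X Y : Finset ℕ} {a : ℕ} {P : Finset (Finset ℕ)}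
    (hP : P ⊆ Y.powerset) (hX : insert a Y ⊆ X) :
    downClo X (P.image (insert a)) = downClo Y P ∪ (downClo Y P).image (insert a) := by
  have hY : ∀ A ∈ P, A ⊆ Y := fun A hA => mem_powerset.1 (hP hA)
  ext S
  simp only [mem_union, mem_image, mem_downClo]
  constructor
  · rintro ⟨-, _, ⟨A, hA, rfl⟩, hSA⟩
    by_cases haS : a ∈ S
    · have h := subset_insert_iff.1 hSA
      exact Or.inr ⟨S.erase a, ⟨h.trans (hY A hA), A, hA, h⟩, insert_erase haS⟩
    · have h := (subset_insert_iff_of_notMem haS).1 hSA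
      exact Or.inl ⟨h.trans (hY A hA), A, hA, h⟩
  · rintro (⟨hS, A, hA, hSA⟩ | ⟨T, ⟨hT, A, hA, hTA⟩, rfl⟩)
    · exact ⟨hS.trans ((subset_insert a Y).trans hX), _, ⟨A, hA, rfl⟩,
        hSA.trans (subset_insert a A)⟩
    · exact ⟨(insert_subset_insert a hT).trans hX, _, ⟨A, hA, rfl⟩, insert_subset_insert a hTA⟩

theorem card_downClo_image_insert {X Y : Finset ℕ} {a : ℕ} {P : Finset (Finset ℕ)}
    (hP : P ⊆ Y.powerset) (ha : a ∉ Y) (hX : insert a Y ⊆ X) :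
    (downClo X (P.image (insert a))).card = 2 * (downClo Y P).card := by
  have haD : ∀ S ∈ downClo Y P, a ∉ S := fun S hS h => ha ((mem_downClo.1 hS).1 h)
  rw [downClo_image_insert hP hX, card_union_of_disjoint, card_image_insert haD, two_mul]
  rw [disjoint_left]
  intro S hS hS'
  obtain ⟨T, -, rfl⟩ := mem_image.1 hS'
  exact haD _ hS (mem_insert_self a T)

theorem upClo_image_insert {Y : Finset ℕ} {a b : ℕ} {P : Finset (Finset ℕ)}
    (hP : P ⊆ Y.powerset) (ha : a ∉ Y) (hb : b ∉ Y) :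
    upClo (insert a (insert b Y)) (P.image (insert a)) =
      (upClo Y P ∪ (upClo Y P).image (insert b)).image (insert a) := by
  have hY : ∀ A ∈ P, A ⊆ Y := fun A hA => mem_powerset.1 (hP hA)
  ext S
  constructor
  · intro hS
    obtain ⟨hSX, A', hA', hAS⟩ := mem_upClo.1 hS
    obtain ⟨A, hA, rfl⟩ := mem_image.1 hA'
    have hAT : A ⊆ S.erase a :=
      subset_erase.2 ⟨(subset_insert a A).trans hAS, fun h => ha (hY A hA h)⟩
    have hT : S.erase a ⊆ insert b Y := subset_insert_iff.1 hSX
    refine mem_image.2 ⟨S.erase a, mem_union.2 ?_, insert_erase (hAS (mem_insert_self a A))⟩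
    by_cases hbT : b ∈ S.erase a
    · refine Or.inr (mem_image.2 ⟨(S.erase a).erase b, mem_upClo.2
        ⟨subset_insert_iff.1 hT, A, hA, subset_erase.2 ⟨hAT, fun h => hb (hY A hA h)⟩⟩,
        insert_erase hbT⟩)
    · exact Or.inl (mem_upClo.2 ⟨(subset_insert_iff_of_notMem hbT).1 hT, A, hA, hAT⟩)
  · intro hS
    obtain ⟨T, hT, rfl⟩ := mem_image.1 hS
    rcases mem_union.1 hT with hT | hT
    · obtain ⟨hTY, A, hA, hAT⟩ := mem_upClo.1 hT
      exact mem_upClo.2 ⟨insert_subset_insert a (hTY.trans (subset_insert b Y)), _,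
        mem_image_of_mem _ hA, insert_subset_insert a hAT⟩
    · obtain ⟨U, hU, rfl⟩ := mem_image.1 hT
      obtain ⟨hUY, A, hA, hAU⟩ := mem_upClo.1 hU
      exact mem_upClo.2 ⟨insert_subset_insert a (insert_subset_insert b hUY), _,
        mem_image_of_mem _ hA, insert_subset_insert a (hAU.trans (subset_insert b U))⟩

theorem card_upClo_image_insert {Y : Finset ℕ} {a b : ℕ} {P : Finset (Finset ℕ)}
    (hP : P ⊆ Y.powerset) (ha : a ∉ Y) (hb : b ∉ Y) (hab : a ≠ b) :
    (upClo (insert a (insert b Y)) (P.image (insert a))).card = 2 * (upClo Y P).card := by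
  have haU : ∀ S ∈ upClo Y P, a ∉ S := fun S hS h => ha ((mem_upClo.1 hS).1 h)
  have hbU : ∀ S ∈ upClo Y P, b ∉ S := fun S hS h => hb ((mem_upClo.1 hS).1 h)
  rw [upClo_image_insert hP ha hb, card_image_insert, card_union_of_disjoint,
    card_image_insert hbU, two_mul]
  · rw [disjoint_left]
    intro S hS hS'
    obtain ⟨T, -, rfl⟩ := mem_image.1 hS'
    exact hbU _ hS (mem_insert_self b T)
  · intro S hS
    rcases mem_union.1 hS with hS | hS
    · exact haU S hS
    · obtain ⟨T, hT, rfl⟩ := mem_image.1 hS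
      simp [hab, haU T hT]

theorem IsConvex.card_udClo_add_card {X : Finset ℕ} {F : Finset (Finset ℕ)}
    (h : IsConvex X F) :
    (udClo X F).card + F.card = (upClo X F).card + (downClo X F).card := by
  have := card_union_add_card_inter (upClo X F) (downClo X F)
  rwa [h] at this

theorem IsConvex.card_udClo_image_insert {Y : Finset ℕ} {a b : ℕ} {P : Finset (Finset ℕ)}
    (hP : IsConvex Y P) (ha : a ∉ Y) (hb : b ∉ Y) (hab : a ≠ b) :
    (udClo (insert a (insert b Y)) (P.image (insert a))).card =
      2 * (udClo Y P).card + P.card := by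
  have hsub := (isConvex_iff.1 hP).1
  have hX : insert a Y ⊆ insert a (insert b Y) := insert_subset_insert a (subset_insert b Y)
  have h := (hP.image_insert ha hX).card_udClo_add_card
  rw [card_upClo_image_insert hsub ha hb hab, card_downClo_image_insert hsub ha hX,
    card_image_insert fun A hA h => ha (mem_powerset.1 (hsub hA) h)] at h
  have := hP.card_udClo_add_card
  omega

theorem groundSet_eq_insert_insert {n : ℕ} (hn : 2 ≤ n) :
    groundSet n = insert 1 (insert n (Icc 2 (n - 1))) := by
  ext k
  simp only [groundSet, mem_Icc, mem_insert]
  omega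

theorem groundSet_map_add_one {n : ℕ} (hn : 2 ≤ n) :
    (groundSet (n - 2)).map (addRightEmbedding 1) = Icc 2 (n - 1) := by
  rw [groundSet, map_add_right_Icc]
  congr 1
  omega

theorem exists_card_udClo_eq_Phi {n m : ℕ} (hm : m ≤ 2 ^ n) :
    ∃ F ⊆ (groundSet n).powerset, F.card = m ∧ (udClo (groundSet n) F).card = Phi n m := by
  obtain ⟨F, hF, hcard⟩ := exists_subset_card_eq (s := (groundSet n).powerset) (n := m)
    (by simpa [groundSet] using hm)
  exact Nat.sInf_mem (s := {k | ∃ F : Finset (Finset ℕ), F ⊆ (groundSet n).powerset ∧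
    F.card = m ∧ (udClo (groundSet n) F).card = k}) ⟨_, F, hF, hcard, rfl⟩

theorem Phi_le {n : ℕ} {F : Finset (Finset ℕ)} (hF : F ⊆ (groundSet n).powerset) :
    Phi n F.card ≤ (udClo (groundSet n) F).card :=
  Nat.sInf_le ⟨F, hF, rfl, rfl⟩

theorem Phi_le_two_mul_Phi_add {n m : ℕ} (hn : 2 ≤ n) (hm : m ≤ 2 ^ (n - 2)) :
    Phi n m ≤ 2 * Phi (n - 2) m + m := by
  obtain ⟨F, hF, hFcard, hFPhi⟩ := exists_card_udClo_eq_Phi hm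
  obtain ⟨G, hG, hGcard, hGle⟩ := exists_isConvex_card_udClo_le hF
  have hQ := hG.map (addRightEmbedding 1)
  have hQud := congrArg card (udClo_map (addRightEmbedding 1) (groundSet (n - 2)) G)
  have hQcard := card_map (mapEmbedding (addRightEmbedding 1)).toEmbedding (s := G)
  rw [card_map] at hQud
  rw [groundSet_map_add_one hn] at hQ hQud
  set Q := G.map (mapEmbedding (addRightEmbedding 1)).toEmbedding
  have h1 : 1 ∉ Icc 2 (n - 1) := by simp
  have hn' : n ∉ Icc 2 (n - 1) := by simp only [mem_Icc]; omega
  have hX : insert 1 (Icc 2 (n - 1)) ⊆ groundSet n := by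
    rw [groundSet_eq_insert_insert hn]
    exact insert_subset_insert 1 (subset_insert n _)
  have hle := Phi_le (isConvex_iff.1 (hQ.image_insert h1 hX)).1
  rw [card_image_insert fun A hA h =>
      h1 (mem_powerset.1 ((isConvex_iff.1 hQ).1 hA) h),
    groundSet_eq_insert_insert hn, hQ.card_udClo_image_insert h1 hn' (by omega), hQud,
    hQcard, hGcard, hFcard] at hle
  omega

/-- Lemma 7: if `𝓟` is a convex family of subsets of `{2,…,n-1}` with `|𝓟| = m ≤ 2^(n-2)`
and `𝓕 = {{1} ∪ P : P ∈ 𝓟}`, then `𝓕` is convex (w.r.t. `[n]`) and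
`|𝓕↕| = 2|𝓟↕| + m` (with `𝓟↕` w.r.t. `{2,…,n-1}`). Hence `Φ(n,m) ≤ 2Φ(n-2,m) + m`. -/
theorem stmt6 (n m : ℕ) (hn : 2 ≤ n) (hm : m ≤ 2 ^ (n - 2))
    (P : Finset (Finset ℕ)) (hP : P ⊆ (Finset.Icc 2 (n - 1)).powerset)
    (hPcard : P.card = m) (hPconv : IsConvex (Finset.Icc 2 (n - 1)) P)
    (F : Finset (Finset ℕ)) (hF : F = P.image (fun A => insert 1 A)) :
    IsConvex (groundSet n) F ∧
    (udClo (groundSet n) F).card = 2 * (udClo (Finset.Icc 2 (n - 1)) P).card + m ∧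
    Phi n m ≤ 2 * Phi (n - 2) m + m := by
  subst hF
  have h1 : 1 ∉ Icc 2 (n - 1) := by simp
  have hn' : n ∉ Icc 2 (n - 1) := by simp only [mem_Icc]; omega
  refine ⟨?_, ?_, Phi_le_two_mul_Phi_add hn hm⟩
  · rw [groundSet_eq_insert_insert hn]
    exact hPconv.image_insert h1 (insert_subset_insert 1 (subset_insert n _))
  · rw [groundSet_eq_insert_insert hn, ← hPcard]
    exact hPconv.card_udClo_image_insert h1 hn' (by omega)
end

section
/- Let 𝓕 be a family of subsets of [n] and let I and J be nonempty disjoint subsets of [n]. Suppose S_{I',J}(𝓕) = 𝓕 for every nonempty proper subset I' of I and S_{I,J'}(𝓕) = 𝓕 for every nonempty proper subset J' of J. Then (i) (S_{I,J}(𝓕))↓ ⊆ S_{I,J}(𝓕↓), hence |(S_{I,J}(𝓕))↓| ≤ |𝓕↓|, and (ii) (S_{I,J}(𝓕))↑ ⊆ S_{I,J}(𝓕↑), hence |(S_{I,J}(𝓕))↑| ≤ |𝓕↑|. -/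
open Finset

/-- The shift `S^𝓕_{I,J}(A)` of a single set `A ∈ 𝓕`. -/
def shiftSet (F : Finset (Finset ℕ)) (I J A : Finset ℕ) : Finset ℕ :=
  if I ∩ A = ∅ ∧ J ⊆ A ∧ (A \ J) ∪ I ∉ F then (A \ J) ∪ I else A

/-- The shifted family `S_{I,J}(𝓕)`. -/
def shiftFam (I J : Finset ℕ) (F : Finset (Finset ℕ)) : Finset (Finset ℕ) :=
  F.image (shiftSet F I J)

theorem mem_shiftFam_of_mem {G : Finset (Finset ℕ)} {I J S : Finset ℕ} (hS : S ∈ G)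
    (h : I ∩ S = ∅ → J ⊆ S → (S \ J) ∪ I ∈ G) : S ∈ shiftFam I J G := by
  refine mem_image.2 ⟨S, hS, if_neg ?_⟩
  rintro ⟨h₁, h₂, h₃⟩
  exact h₃ (h h₁ h₂)

theorem mem_shiftFam_of_swap_mem {G : Finset (Finset ℕ)} {I J S : Finset ℕ}
    (hdisj : Disjoint I J) (hIS : I ⊆ S) (hJS : Disjoint J S) (h : (S \ I) ∪ J ∈ G) :
    S ∈ shiftFam I J G := by
  have hswap : (((S \ I) ∪ J) \ J) ∪ I = S := by
    rw [Finset.disjoint_left] at hdisj hJS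
    grind
  by_cases hS : S ∈ G
  · refine mem_shiftFam_of_mem hS fun h₁ h₂ => ?_
    have hJ : J = ∅ := by rw [Finset.disjoint_left] at hJS; grind
    have hI : I = ∅ := by grind
    simpa [hI, hJ] using hS
  · refine mem_image.2 ⟨_, h, ?_⟩
    rw [shiftSet, hswap, if_pos]
    refine ⟨?_, subset_union_right, hS⟩
    rw [Finset.disjoint_left] at hdisj
    grind

/-- A member of a shifted family is either an old member whose own shift, if defined, is also an
old member, or the shift of an old member. -/
theorem mem_or_eq_of_mem_shiftFam {G : Finset (Finset ℕ)} {I J B : Finset ℕ}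
    (hB : B ∈ shiftFam I J G) :
    (B ∈ G ∧ (I ∩ B = ∅ → J ⊆ B → (B \ J) ∪ I ∈ G)) ∨
      ∃ A ∈ G, I ∩ A = ∅ ∧ J ⊆ A ∧ B = (A \ J) ∪ I := by
  obtain ⟨A, hA, rfl⟩ := mem_image.1 hB
  unfold shiftSet
  split_ifs with h
  · exact Or.inr ⟨A, hA, h.1, h.2.1, rfl⟩
  · refine Or.inl ⟨hA, fun h₁ h₂ => ?_⟩
    by_contra h₃
    exact h ⟨h₁, h₂, h₃⟩

theorem shift_mem_of_shiftFam_eq {G : Finset (Finset ℕ)} {I J A : Finset ℕ}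
    (h : shiftFam I J G = G) (hA : A ∈ G) (hIA : I ∩ A = ∅) (hJA : J ⊆ A) :
    (A \ J) ∪ I ∈ G := by
  by_contra hn
  have hmem : shiftSet G I J A ∈ shiftFam I J G := mem_image_of_mem _ hA
  rw [h, shiftSet, if_pos ⟨hIA, hJA, hn⟩] at hmem
  exact hn hmem

theorem downClo_shiftFam_subset {X I J : Finset ℕ} {F : Finset (Finset ℕ)}
    (hI : I ⊆ X) (hJ : J ⊆ X) (hJne : J.Nonempty) (hdisj : Disjoint I J)
    (hI' : ∀ I' ⊆ I, I'.Nonempty → I' ≠ I → shiftFam I' J F = F) :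
    downClo X (shiftFam I J F) ⊆ shiftFam I J (downClo X F) := by
  intro S hS
  obtain ⟨hSX, B, hB, hSB⟩ := mem_downClo.1 hS
  have hd := Finset.disjoint_left.1 hdisj
  rcases mem_or_eq_of_mem_shiftFam hB with ⟨hBF, hBs⟩ | ⟨A, hA, hIA, hJA, rfl⟩
  · refine mem_shiftFam_of_mem (mem_downClo.2 ⟨hSX, B, hBF, hSB⟩) fun hIS hJS => ?_
    refine mem_downClo.2 ⟨union_subset (sdiff_subset.trans hSX) hI, ?_⟩
    by_cases h₁ : I ∩ B = ∅
    · exact ⟨_, hBs h₁ (hJS.trans hSB), by gcongr⟩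
    by_cases h₂ : I ⊆ B
    · exact ⟨B, hBF, union_subset (sdiff_subset.trans hSB) h₂⟩
    refine ⟨(B \ J) ∪ (I \ B), shift_mem_of_shiftFam_eq
      (hI' (I \ B) sdiff_subset (sdiff_nonempty.2 h₂) (by grind)) hBF (by grind)
      (hJS.trans hSB), by grind⟩
  · by_cases h₁ : I ⊆ S
    · refine mem_shiftFam_of_swap_mem hdisj h₁ (Finset.disjoint_left.2 (by grind))
        (mem_downClo.2 ⟨union_subset (sdiff_subset.trans hSX) hJ, A, hA, by grind⟩)
    have hSF : ∃ C ∈ F, S ⊆ C := by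
      rcases (I ∩ S).eq_empty_or_nonempty with h₂ | h₂
      · rw [← disjoint_iff_inter_eq_empty, Finset.disjoint_left] at h₂
        exact ⟨A, hA, by grind⟩
      · exact ⟨(A \ J) ∪ (I ∩ S), shift_mem_of_shiftFam_eq
          (hI' _ inter_subset_left h₂ (by grind)) hA (by grind) hJA, by grind⟩
    refine mem_shiftFam_of_mem (mem_downClo.2 ⟨hSX, hSF⟩) fun hIS hJS => ?_
    obtain ⟨j, hj⟩ := hJne
    grind

theorem upClo_shiftFam_subset {X I J : Finset ℕ} {F : Finset (Finset ℕ)}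
    (hI : I ⊆ X) (hJ : J ⊆ X) (hIne : I.Nonempty) (hdisj : Disjoint I J)
    (hJ' : ∀ J' ⊆ J, J'.Nonempty → J' ≠ J → shiftFam I J' F = F) :
    upClo X (shiftFam I J F) ⊆ shiftFam I J (upClo X F) := by
  intro S hS
  obtain ⟨hSX, B, hB, hBS⟩ := mem_upClo.1 hS
  have hd := Finset.disjoint_left.1 hdisj
  rcases mem_or_eq_of_mem_shiftFam hB with ⟨hBF, hBs⟩ | ⟨A, hA, hIA, hJA, rfl⟩
  · refine mem_shiftFam_of_mem (mem_upClo.2 ⟨hSX, B, hBF, hBS⟩) fun hIS hJS => ?_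
    refine mem_upClo.2 ⟨union_subset (sdiff_subset.trans hSX) hI, ?_⟩
    have hIB : I ∩ B = ∅ := by grind
    by_cases h₁ : J ⊆ B
    · exact ⟨_, hBs hIB h₁, by gcongr⟩
    rcases (J ∩ B).eq_empty_or_nonempty with h₂ | h₂
    · rw [← disjoint_iff_inter_eq_empty, Finset.disjoint_left] at h₂
      exact ⟨B, hBF, by grind⟩
    · exact ⟨(B \ (J ∩ B)) ∪ I, shift_mem_of_shiftFam_eq
        (hJ' _ inter_subset_left h₂ (by grind)) hBF hIB inter_subset_right, by grind⟩
  · have hIS : I ⊆ S := subset_union_right.trans hBS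
    by_cases h₁ : Disjoint J S
    · exact mem_shiftFam_of_swap_mem hdisj hIS h₁
        (mem_upClo.2 ⟨union_subset (sdiff_subset.trans hSX) hJ, A, hA, fun x hx => by
          have := Finset.disjoint_left.1 (disjoint_iff_inter_eq_empty.2 hIA)
          grind⟩)
    have hSF : ∃ C ∈ F, C ⊆ S := by
      by_cases h₂ : J ⊆ S
      · exact ⟨A, hA, by grind⟩
      · rw [Finset.disjoint_left] at h₁
        exact ⟨(A \ (J \ S)) ∪ I, shift_mem_of_shiftFam_eq
          (hJ' _ sdiff_subset (sdiff_nonempty.2 h₂) (by grind)) hA hIA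
          (sdiff_subset.trans hJA), by grind⟩
    refine mem_shiftFam_of_mem (mem_upClo.2 ⟨hSX, hSF⟩) fun hIS' _ => ?_
    rw [inter_eq_left.2 hIS] at hIS'
    exact absurd hIS' hIne.ne_empty

/-- Lemma 9: if `S_{I',J}(𝓕) = 𝓕` for all nonempty proper subsets `I'` of `I` and
`S_{I,J'}(𝓕) = 𝓕` for all nonempty proper subsets `J'` of `J`, then
(i) `(S_{I,J}(𝓕))↓ ⊆ S_{I,J}(𝓕↓)` and hence `|(S_{I,J}(𝓕))↓| ≤ |𝓕↓|`;
(ii) `(S_{I,J}(𝓕))↑ ⊆ S_{I,J}(𝓕↑)` and hence `|(S_{I,J}(𝓕))↑| ≤ |𝓕↑|`. -/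
theorem stmt8 (n : ℕ) (F : Finset (Finset ℕ)) (hF : F ⊆ (groundSet n).powerset)
    (I J : Finset ℕ) (hI : I ⊆ groundSet n) (hJ : J ⊆ groundSet n)
    (hIne : I.Nonempty) (hJne : J.Nonempty) (hdisj : Disjoint I J)
    (hI' : ∀ I' ⊆ I, I'.Nonempty → I' ≠ I → shiftFam I' J F = F)
    (hJ' : ∀ J' ⊆ J, J'.Nonempty → J' ≠ J → shiftFam I J' F = F) :
    (downClo (groundSet n) (shiftFam I J F) ⊆ shiftFam I J (downClo (groundSet n) F) ∧
      (downClo (groundSet n) (shiftFam I J F)).card ≤ (downClo (groundSet n) F).card) ∧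
    (upClo (groundSet n) (shiftFam I J F) ⊆ shiftFam I J (upClo (groundSet n) F) ∧
      (upClo (groundSet n) (shiftFam I J F)).card ≤ (upClo (groundSet n) F).card) := by
  have hdown := downClo_shiftFam_subset (F := F) hI hJ hJne hdisj hI'
  have hup := upClo_shiftFam_subset (F := F) hI hJ hIne hdisj hJ'
  exact ⟨⟨hdown, (card_le_card hdown).trans card_image_le⟩,
    ⟨hup, (card_le_card hup).trans card_image_le⟩⟩
end

section
/- Let n ≥ 2 and let 𝓕 be a strongly shifted family of subsets of [n] with |𝓕| = m, where m ≤ 2^{n−2}. Let 𝓒 = {A ⊆ [n] : {1} ⊆ A ⊆ [n−1]}. If 𝓕 ⊄ 𝓒 (i.e. 𝓕 is not a subfamily of 𝓒), then |𝓕↕| ≥ 2^{n−1} + m. -/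
open Finset

/-- A family of subsets of `[n]` is strongly shifted if `S_{I,J}(𝓕) = 𝓕` for all
nonempty disjoint `I, J ⊆ [n]` with `max I < min J`. -/
def StronglyShifted (n : ℕ) (F : Finset (Finset ℕ)) : Prop :=
  ∀ I J : Finset ℕ, I ⊆ groundSet n → J ⊆ groundSet n →
    ∀ (hI : I.Nonempty) (hJ : J.Nonempty),
      Disjoint I J → I.max' hI < J.min' hJ → shiftFam I J F = F

theorem StronglyShifted.sdiff_union_mem {n : ℕ} {F : Finset (Finset ℕ)}
    (h : StronglyShifted n F) {A I J : Finset ℕ} (hA : A ∈ F)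
    (hI : I ⊆ groundSet n) (hJ : J ⊆ groundSet n) (hI' : I.Nonempty) (hJ' : J.Nonempty)
    (hIA : Disjoint I A) (hJA : J ⊆ A) (hlt : ∀ i ∈ I, ∀ j ∈ J, i < j) :
    A \ J ∪ I ∈ F := by
  by_contra hn
  have hs := h I J hI hJ hI' hJ' (hIA.mono_right hJA)
    (hlt _ (I.max'_mem hI') _ (J.min'_mem hJ'))
  have hmem : shiftSet F I J A ∈ shiftFam I J F := mem_image_of_mem _ hA
  rw [hs, shiftSet, if_pos ⟨disjoint_iff_inter_eq_empty.1 hIA, hJA, hn⟩] at hmem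
  exact hn hmem

theorem mem_groundSet {n i : ℕ} : i ∈ groundSet n ↔ 1 ≤ i ∧ i ≤ n := by
  simp [groundSet]

theorem card_groundSet (n : ℕ) : (groundSet n).card = n := by
  simp [groundSet]

theorem mem_udClo {X S : Finset ℕ} {F : Finset (Finset ℕ)} :
    S ∈ udClo X F ↔ S ⊆ X ∧ ∃ A ∈ F, A ⊆ S ∨ S ⊆ A := by
  simp only [udClo, upClo, downClo, mem_union, mem_filter, mem_powerset]
  grind

/-- If a member of a strongly shifted family misses `1`, every set containing `1` lies in `𝓕↕`. -/
theorem StronglyShifted.mem_udClo_of_one_mem {n : ℕ} (hn : 1 ≤ n) {F : Finset (Finset ℕ)}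
    (h : StronglyShifted n F) {A S : Finset ℕ} (hA : A ∈ F) (hAX : A ⊆ groundSet n)
    (h1 : 1 ∉ A) (hS : S ⊆ groundSet n) (h1S : 1 ∈ S) : S ∈ udClo (groundSet n) F := by
  rw [mem_udClo]
  refine ⟨hS, ?_⟩
  rcases A.eq_empty_or_nonempty with rfl | hne
  · exact ⟨∅, hA, Or.inl (empty_subset _)⟩
  · have hmem := h.sdiff_union_mem (I := {1}) (J := A) hA
      (by simpa [mem_groundSet] using hn) hAX (singleton_nonempty 1) hne
      (by simpa using h1) subset_rfl (by
        intro i hi j hj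
        rw [mem_singleton] at hi
        have := (mem_groundSet.1 (hAX hj)).1
        have : j ≠ 1 := fun e => h1 (e ▸ hj)
        omega)
    exact ⟨_, hmem, Or.inl (by simpa using h1S)⟩

/-- If a member of a strongly shifted family contains `n`, every set missing `n` lies in `𝓕↕`. -/
theorem StronglyShifted.mem_udClo_of_notMem {n : ℕ} {F : Finset (Finset ℕ)}
    (h : StronglyShifted n F) {A S : Finset ℕ} (hA : A ∈ F) (hAX : A ⊆ groundSet n)
    (hnA : n ∈ A) (hS : S ⊆ groundSet n) (hnS : n ∉ S) : S ∈ udClo (groundSet n) F := by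
  rw [mem_udClo]
  refine ⟨hS, ?_⟩
  rcases (groundSet n \ A).eq_empty_or_nonempty with he | hne
  · exact ⟨A, hA, Or.inr (hS.trans (sdiff_eq_empty_iff_subset.1 he))⟩
  · have hmem := h.sdiff_union_mem (I := groundSet n \ A) (J := {n}) hA
      sdiff_subset (by simpa using hAX hnA) hne (singleton_nonempty n)
      sdiff_disjoint (by simpa using hnA) (by
        intro i hi j hj
        rw [mem_singleton] at hj
        rw [mem_sdiff, mem_groundSet] at hi
        have : i ≠ n := fun e => hi.2 (e ▸ hnA)
        omega)
    refine ⟨_, hmem, Or.inr fun x hx => ?_⟩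
    have := hS hx
    have : x ≠ n := fun e => hnS (e ▸ hx)
    grind

theorem card_filter_mem_powerset {X : Finset ℕ} {a : ℕ} (ha : a ∈ X) :
    (X.powerset.filter (fun S => a ∈ S)).card = 2 ^ (X.card - 1) := by
  have he : X.powerset.filter (fun S => a ∈ S) = (X.erase a).powerset.image (insert a) := by
    ext S
    simp only [mem_filter, mem_powerset, mem_image]
    constructor
    · rintro ⟨hS, haS⟩
      exact ⟨S.erase a, erase_subset_erase a hS, insert_erase haS⟩
    · rintro ⟨T, hT, rfl⟩
      exact ⟨insert_subset ha (hT.trans (erase_subset a X)), mem_insert_self a T⟩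
  rw [he, card_image_of_injOn, card_powerset, card_erase_of_mem ha]
  intro S hS T hT hST
  have hS' : S ⊆ X.erase a := mem_powerset.1 (mem_coe.1 hS)
  have hT' : T ⊆ X.erase a := mem_powerset.1 (mem_coe.1 hT)
  rw [← erase_insert (fun h => notMem_erase a X (hS' h)), hST,
    erase_insert (fun h => notMem_erase a X (hT' h))]

theorem card_add_card_le_of_image {α β : Type*} [DecidableEq β] {s U : Finset β} {F : Finset α}
    {f : α → β} (hs : s ⊆ U) (hf : ∀ A ∈ F, f A ∈ U) (hfs : ∀ A ∈ F, f A ∉ s)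
    (hinj : Set.InjOn f F) : s.card + F.card ≤ U.card := by
  rw [← card_image_of_injOn hinj, ← card_union_of_disjoint]
  · exact card_le_card (union_subset hs (image_subset_iff.2 hf))
  · rw [disjoint_right]
    simpa [mem_image] using hfs

/-- Lemma 11: if `𝓕` is a strongly shifted `(n,m)`-family with `m ≤ 2^(n-2)` and
`𝓕 ⊈ 𝒞 = {A ⊆ [n] : {1} ⊆ A ⊆ [n-1]}`, then `|𝓕↕| ≥ 2^(n-1) + m`. -/
theorem stmt10 (n m : ℕ) (hn : 2 ≤ n) (hm : m ≤ 2 ^ (n - 2))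
    (F : Finset (Finset ℕ)) (hF : F ⊆ (groundSet n).powerset) (hcard : F.card = m)
    (hss : StronglyShifted n F)
    (hns : ¬ F ⊆ (groundSet n).powerset.filter (fun A => 1 ∈ A ∧ A ⊆ groundSet (n - 1))) :
    2 ^ (n - 1) + m ≤ (udClo (groundSet n) F).card := by
  have hX : ∀ A ∈ F, A ⊆ groundSet n := fun A hA => mem_powerset.1 (hF hA)
  have h1X : 1 ∈ groundSet n := mem_groundSet.2 ⟨le_rfl, by omega⟩
  have hnX : n ∈ groundSet n := mem_groundSet.2 ⟨by omega, le_rfl⟩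
  have hn1 : n ≠ 1 := by omega
  have hcard1 := card_filter_mem_powerset h1X
  rw [card_groundSet] at hcard1
  by_cases h1 : ∃ A ∈ F, 1 ∉ A
  · obtain ⟨A, hA, h1A⟩ := h1
    have hstar : (groundSet n).powerset.filter (fun S => 1 ∈ S) ⊆ udClo (groundSet n) F := by
      intro S hS
      rw [mem_filter, mem_powerset] at hS
      exact hss.mem_udClo_of_one_mem (by omega) hA (hX A hA) h1A hS.1 hS.2
    by_cases hB : ∃ B ∈ F, n ∈ B
    · obtain ⟨B, hB, hnB⟩ := hB
      have hsmall : (((groundSet n).erase 1).erase n).powerset.card = 2 ^ (n - 2) := by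
        rw [card_powerset, card_erase_of_mem (mem_erase.2 ⟨hn1, hnX⟩), card_erase_of_mem h1X,
          card_groundSet, Nat.sub_sub]
      refine (Nat.add_le_add hcard1.ge (hm.trans hsmall.ge)).trans
        (card_add_card_le_of_image (f := id) hstar ?_ ?_ Function.injective_id.injOn)
      · intro S hS
        rw [mem_powerset] at hS
        exact hss.mem_udClo_of_notMem hB (hX B hB) hnB (fun x hx => by have := hS hx; grind)
          (fun hx => by have := hS hx; grind)
      · intro S hS
        rw [mem_powerset] at hS
        rw [mem_filter]
        exact fun h => by have := hS h.2; grind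
    · push Not at hB
      rw [← hcard1, ← hcard]
      refine card_add_card_le_of_image (f := fun A => if 1 ∈ A then A.erase 1 else insert n A)
        hstar ?_ ?_ ?_
      · intro A hA
        have := hX A hA
        rw [mem_udClo]
        split_ifs
        · exact ⟨(erase_subset 1 A).trans this, A, hA, Or.inr (erase_subset 1 A)⟩
        · exact ⟨insert_subset hnX this, A, hA, Or.inl (subset_insert n A)⟩
      · intro A hA
        rw [mem_filter]
        grind
      · intro A hA B hB' hAB
        have hnA := hB A hA
        have hnB := hB B hB'
        dsimp only at hAB
        split_ifs at hAB with h h' h'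
        · rw [← insert_erase h, hAB, insert_erase h']
        · have : n ∈ A.erase 1 := hAB ▸ mem_insert_self n B
          grind
        · have : n ∈ B.erase 1 := hAB ▸ mem_insert_self n A
          grind
        · rw [← erase_insert hnA, hAB, erase_insert hnB]
  · push Not at h1
    obtain ⟨A, hA, hnA⟩ : ∃ A ∈ F, n ∈ A := by
      by_contra! hno
      refine hns fun A hA => ?_
      rw [mem_filter]
      refine ⟨hF hA, h1 A hA, fun x hx => ?_⟩
      have := mem_groundSet.1 (hX A hA hx)
      have : x ≠ n := fun e => hno A hA (e ▸ hx)
      rw [mem_groundSet]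
      omega
    have hcardn : ((groundSet n).erase n).powerset.card = 2 ^ (n - 1) := by
      rw [card_powerset, card_erase_of_mem hnX, card_groundSet]
    rw [← hcardn, ← hcard]
    refine card_add_card_le_of_image (f := fun A => if n ∈ A then A.erase 1 else insert n A)
      ?_ ?_ ?_ ?_
    · intro S hS
      rw [mem_powerset] at hS
      exact hss.mem_udClo_of_notMem hA (hX A hA) hnA (hS.trans (erase_subset _ _))
        (fun h => notMem_erase n _ (hS h))
    · intro A hA
      have := hX A hA
      rw [mem_udClo]
      split_ifs
      · exact ⟨(erase_subset 1 A).trans this, A, hA, Or.inr (erase_subset 1 A)⟩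
      · exact ⟨insert_subset hnX this, A, hA, Or.inl (subset_insert n A)⟩
    · intro A hA
      rw [mem_powerset]
      intro h
      refine notMem_erase n (groundSet n) (h ?_)
      split_ifs with h'
      · exact mem_erase.2 ⟨hn1, h'⟩
      · exact mem_insert_self n A
    · intro A hA B hB hAB
      have h1A := h1 A hA
      have h1B := h1 B hB
      dsimp only at hAB
      split_ifs at hAB with h h' h'
      · rw [← insert_erase h1A, hAB, insert_erase h1B]
      · have : 1 ∈ A.erase 1 := hAB ▸ mem_insert_of_mem h1B
        grind
      · have : 1 ∈ B.erase 1 := hAB ▸ mem_insert_of_mem h1A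
        grind
      · rw [← erase_insert h, hAB, erase_insert h']
end

section
/- Let n and k be integers with 0 ≤ k ≤ n. Let 𝓕₁ be a convex family of subsets of [k] with [k] ∈ 𝓕₁, let 𝓕₂ be a convex family of subsets of [n] ∖ [k] with ∅ ∈ 𝓕₂, and let 𝓕 = {F₁ ∪ F₂ : F₁ ∈ 𝓕₁, F₂ ∈ 𝓕₂}, regarded as a family of subsets of [n]. Then |𝓕| = |𝓕₁|·|𝓕₂| and |𝓕↕| = 2^{n−k}·|𝓕₁| + 2^k·|𝓕₂| − |𝓕₁|·|𝓕₂|, where 𝓕↕ is taken with respect to the ground set [n]. -/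
open Finset

/-- The family `{A ∪ B : A ∈ 𝓐, B ∈ 𝓑}`. -/
def unionFamily (𝓐 𝓑 : Finset (Finset ℕ)) : Finset (Finset ℕ) :=
  (𝓐 ×ˢ 𝓑).image fun p => p.1 ∪ p.2

section

variable {X Y S : Finset ℕ} {𝓐 𝓑 : Finset (Finset ℕ)}

lemma mem_unionFamily_iff (hXY : Disjoint X Y) (h𝓐 : 𝓐 ⊆ X.powerset) (h𝓑 : 𝓑 ⊆ Y.powerset) :
    S ∈ unionFamily 𝓐 𝓑 ↔ S ⊆ X ∪ Y ∧ S ∩ X ∈ 𝓐 ∧ S ∩ Y ∈ 𝓑 := by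
  simp only [unionFamily, mem_image, mem_product, Prod.exists]
  constructor
  · rintro ⟨A, B, ⟨hA, hB⟩, rfl⟩
    have hAX := mem_powerset.1 (h𝓐 hA)
    have hBY := mem_powerset.1 (h𝓑 hB)
    refine ⟨union_subset_union hAX hBY, ?_, ?_⟩
    · rwa [union_inter_distrib_right, inter_eq_left.2 hAX,
        disjoint_iff_inter_eq_empty.1 (hXY.symm.mono_left hBY), union_empty]
    · rwa [union_inter_distrib_right, inter_eq_left.2 hBY,
        disjoint_iff_inter_eq_empty.1 (hXY.mono_left hAX), empty_union]
  · rintro ⟨hS, hX, hY⟩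
    exact ⟨S ∩ X, S ∩ Y, ⟨hX, hY⟩, by rw [← inter_union_distrib_left, inter_eq_left.2 hS]⟩

lemma card_unionFamily (hXY : Disjoint X Y) (h𝓐 : 𝓐 ⊆ X.powerset) (h𝓑 : 𝓑 ⊆ Y.powerset) :
    (unionFamily 𝓐 𝓑).card = 𝓐.card * 𝓑.card := by
  rw [unionFamily, card_image_of_injOn, card_product]
  rintro ⟨A, B⟩ hp ⟨A', B'⟩ hp' h
  simp only [coe_product, Set.mem_prod, mem_coe] at hp hp' h
  have hA := mem_powerset.1 (h𝓐 hp.1)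
  have hB := mem_powerset.1 (h𝓑 hp.2)
  have hA' := mem_powerset.1 (h𝓐 hp'.1)
  have hB' := mem_powerset.1 (h𝓑 hp'.2)
  have hX := congrArg (· ∩ X) h
  have hY := congrArg (· ∩ Y) h
  simp only [union_inter_distrib_right, inter_eq_left.2 hA, inter_eq_left.2 hA',
    disjoint_iff_inter_eq_empty.1 (hXY.symm.mono_left hB),
    disjoint_iff_inter_eq_empty.1 (hXY.symm.mono_left hB'), union_empty] at hX
  simp only [union_inter_distrib_right, inter_eq_left.2 hB, inter_eq_left.2 hB',
    disjoint_iff_inter_eq_empty.1 (hXY.mono_left hA),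
    disjoint_iff_inter_eq_empty.1 (hXY.mono_left hA'), empty_union] at hY
  rw [hX, hY]

lemma IsConvex.upClo_eq (h : IsConvex X 𝓐) (htop : X ∈ 𝓐) : upClo X 𝓐 = 𝓐 := by
  refine Eq.trans (inter_eq_left.2 fun S hS => ?_).symm h
  have hSX := (mem_filter.1 hS).1
  exact mem_filter.2 ⟨hSX, X, htop, mem_powerset.1 hSX⟩

lemma IsConvex.downClo_eq (h : IsConvex X 𝓐) (hbot : ∅ ∈ 𝓐) : downClo X 𝓐 = 𝓐 := by
  refine Eq.trans (inter_eq_right.2 fun S hS => ?_).symm h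
  exact mem_filter.2 ⟨(mem_filter.1 hS).1, ∅, hbot, empty_subset S⟩

lemma upClo_unionFamily (hXY : Disjoint X Y) (h𝓐 : 𝓐 ⊆ X.powerset) (hup : upClo X 𝓐 = 𝓐)
    (hbot : ∅ ∈ 𝓑) (h𝓑 : 𝓑 ⊆ Y.powerset) :
    upClo (X ∪ Y) (unionFamily 𝓐 𝓑) = unionFamily 𝓐 Y.powerset := by
  ext S
  rw [mem_unionFamily_iff hXY h𝓐 Subset.rfl]
  simp only [upClo, mem_filter, mem_powerset, inter_subset_right, and_true]
  refine and_congr_right fun _ => ⟨?_, fun h => ?_⟩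
  · rintro ⟨T, hT, hTS⟩
    rw [← hup]
    exact mem_filter.2 ⟨mem_powerset.2 inter_subset_right, T ∩ X,
      ((mem_unionFamily_iff hXY h𝓐 h𝓑).1 hT).2.1, inter_subset_inter_right hTS⟩
  · exact ⟨S ∩ X, mem_image.2 ⟨(S ∩ X, ∅), mem_product.2 ⟨h, hbot⟩, union_empty _⟩,
      inter_subset_left⟩

lemma downClo_unionFamily (hXY : Disjoint X Y) (h𝓐 : 𝓐 ⊆ X.powerset) (htop : X ∈ 𝓐)
    (h𝓑 : 𝓑 ⊆ Y.powerset) (hdown : downClo Y 𝓑 = 𝓑) :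
    downClo (X ∪ Y) (unionFamily 𝓐 𝓑) = unionFamily X.powerset 𝓑 := by
  ext S
  rw [mem_unionFamily_iff hXY Subset.rfl h𝓑]
  simp only [downClo, mem_filter, mem_powerset, inter_subset_right, true_and]
  refine and_congr_right fun hS => ⟨?_, fun h => ?_⟩
  · rintro ⟨T, hT, hST⟩
    rw [← hdown]
    exact mem_filter.2 ⟨mem_powerset.2 inter_subset_right, T ∩ Y,
      ((mem_unionFamily_iff hXY h𝓐 h𝓑).1 hT).2.2, inter_subset_inter_right hST⟩
  · refine ⟨X ∪ S ∩ Y, mem_image.2 ⟨(X, S ∩ Y), mem_product.2 ⟨htop, h⟩, rfl⟩, ?_⟩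
    rw [union_inter_distrib_left]
    exact subset_inter subset_union_right hS

lemma unionFamily_powerset_inter (hXY : Disjoint X Y) (h𝓐 : 𝓐 ⊆ X.powerset)
    (h𝓑 : 𝓑 ⊆ Y.powerset) :
    unionFamily 𝓐 Y.powerset ∩ unionFamily X.powerset 𝓑 = unionFamily 𝓐 𝓑 := by
  ext S
  rw [mem_inter, mem_unionFamily_iff hXY h𝓐 Subset.rfl, mem_unionFamily_iff hXY Subset.rfl h𝓑,
    mem_unionFamily_iff hXY h𝓐 h𝓑]
  simp only [mem_powerset, inter_subset_right]
  tauto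

lemma card_udClo_unionFamily (hXY : Disjoint X Y) (h𝓐 : 𝓐 ⊆ X.powerset) (hconv𝓐 : IsConvex X 𝓐)
    (htop : X ∈ 𝓐) (h𝓑 : 𝓑 ⊆ Y.powerset) (hconv𝓑 : IsConvex Y 𝓑) (hbot : ∅ ∈ 𝓑) :
    (udClo (X ∪ Y) (unionFamily 𝓐 𝓑)).card =
      2 ^ Y.card * 𝓐.card + 2 ^ X.card * 𝓑.card - 𝓐.card * 𝓑.card := by
  rw [udClo, upClo_unionFamily hXY h𝓐 (hconv𝓐.upClo_eq htop) hbot h𝓑,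
    downClo_unionFamily hXY h𝓐 htop h𝓑 (hconv𝓑.downClo_eq hbot), card_union,
    unionFamily_powerset_inter hXY h𝓐 h𝓑, card_unionFamily hXY h𝓐 Subset.rfl,
    card_unionFamily hXY Subset.rfl h𝓑, card_unionFamily hXY h𝓐 h𝓑, card_powerset,
    card_powerset, mul_comm 𝓐.card (2 ^ _)]

end

/-- Lemma 12: for `0 ≤ k ≤ n`, a convex family `𝓕₁` of subsets of `[k]` containing `[k]`
and a convex family `𝓕₂` of subsets of `[n] ∖ [k] = {k+1,…,n}` containing `∅`, the
family `𝓕 = {F₁ ∪ F₂ : F₁ ∈ 𝓕₁, F₂ ∈ 𝓕₂}` satisfies `|𝓕| = |𝓕₁||𝓕₂|` and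
`|𝓕↕| = 2^(n-k)|𝓕₁| + 2^k|𝓕₂| - |𝓕₁||𝓕₂|` (closure w.r.t. `[n]`). -/
theorem stmt11 (n k : ℕ) (hk : k ≤ n)
    (F1 : Finset (Finset ℕ)) (hF1 : F1 ⊆ (groundSet k).powerset)
    (hF1conv : IsConvex (groundSet k) F1) (htop : groundSet k ∈ F1)
    (F2 : Finset (Finset ℕ)) (hF2 : F2 ⊆ (Finset.Icc (k + 1) n).powerset)
    (hF2conv : IsConvex (Finset.Icc (k + 1) n) F2) (hbot : (∅ : Finset ℕ) ∈ F2)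
    (F : Finset (Finset ℕ)) (hF : F = (F1 ×ˢ F2).image (fun p => p.1 ∪ p.2)) :
    F.card = F1.card * F2.card ∧
    (udClo (groundSet n) F).card =
      2 ^ (n - k) * F1.card + 2 ^ k * F2.card - F1.card * F2.card := by
  have hdisj : Disjoint (groundSet k) (Icc (k + 1) n) := by
    rw [disjoint_left]
    simp only [groundSet, mem_Icc]
    lia
  have hunion : groundSet n = groundSet k ∪ Icc (k + 1) n := by
    ext i
    simp only [groundSet, mem_union, mem_Icc]
    lia
  obtain rfl : F = unionFamily F1 F2 := hF
  refine ⟨card_unionFamily hdisj hF1 hF2, ?_⟩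
  rw [hunion, card_udClo_unionFamily hdisj hF1 hF1conv htop hF2 hF2conv hbot]
  simp [groundSet]
end

section
/- Let m and n be nonnegative integers with n ≥ 2 and m ≤ 2^{n−2}. There exists a family 𝓕 of subsets of [n] with |𝓕| = m and |𝓕↕| = Φ(n,m) such that 𝓕 is convex and 𝓕 ⊆ 𝓒, where 𝓒 = {A ⊆ [n] : {1} ⊆ A ⊆ [n−1]}. -/
open Finset

/-! ### The extremal overlap function -/

/-- `maxOverlap n u d` is the largest possible size of the intersection of an up-set of size `u`
and a down-set of size `d` in the `n`-dimensional Boolean lattice. -/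
def maxOverlap : ℕ → ℕ → ℕ → ℕ
  | 0, u, d => min u d
  | n + 1, u, d =>
    if u ≤ 2 ^ n then maxOverlap n u (d / 2)
    else d / 2 + maxOverlap n (u - 2 ^ n) ((d + 1) / 2)

namespace maxOverlap

lemma zero_left (n d : ℕ) : maxOverlap n 0 d = 0 := by
  induction n generalizing d with
  | zero => simp [maxOverlap]
  | succ n ih => simp [maxOverlap, ih]

lemma full_left (n d : ℕ) (hd : d ≤ 2 ^ n) : maxOverlap n (2 ^ n) d = d := by
  induction n generalizing d with
  | zero => simpa [maxOverlap] using hd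
  | succ n ih =>
    have hp : 0 < 2 ^ n := by positivity
    have h2 : 2 ^ (n + 1) = 2 * 2 ^ n := by ring
    rw [maxOverlap, if_neg (by omega), show 2 ^ (n + 1) - 2 ^ n = 2 ^ n by omega,
      ih _ (by omega)]
    omega

lemma succ_of_le {n u : ℕ} (d : ℕ) (hu : u ≤ 2 ^ n) :
    maxOverlap (n + 1) u d = maxOverlap n u (d / 2) := by
  rw [maxOverlap, if_pos hu]

lemma succ_of_ge {n u d : ℕ} (hu : 2 ^ n ≤ u) (hd : d ≤ 2 ^ (n + 1)) :
    maxOverlap (n + 1) u d = d / 2 + maxOverlap n (u - 2 ^ n) ((d + 1) / 2) := by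
  rcases hu.eq_or_lt with h | h
  · rw [← h, succ_of_le _ le_rfl, full_left _ _ (by rw [pow_succ] at hd; omega), Nat.sub_self,
      zero_left, add_zero]
  · rw [maxOverlap, if_neg (by omega)]

lemma succ_right {n u d : ℕ} (hu : u ≤ 2 ^ (n + 1)) (hd : d ≤ 2 ^ (n + 1)) :
    (d ≤ 2 ^ n → maxOverlap (n + 1) u d = maxOverlap n (u / 2) d) ∧
      (2 ^ n ≤ d →
        maxOverlap (n + 1) u d = u / 2 + maxOverlap n ((u + 1) / 2) (d - 2 ^ n)) := by
  induction n generalizing u d with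
  | zero =>
    norm_num at hu hd
    interval_cases u <;> interval_cases d <;> simp [maxOverlap]
  | succ n ih =>
    have h1 : 2 ^ (n + 1) = 2 * 2 ^ n := by ring
    have h2 : 2 ^ (n + 1 + 1) = 2 * 2 ^ (n + 1) := by ring
    rcases le_total u (2 ^ (n + 1)) with hu' | hu'
    · rw [succ_of_le _ hu']
      obtain ⟨ia, ib⟩ := ih hu' (d := d / 2) (by omega)
      constructor <;> intro h
      · rw [ia (by omega), succ_of_le _ (by omega)]
      · rw [ib (by omega), succ_of_le _ (by omega)]
        congr 2
        omega
    · rw [succ_of_ge hu' hd]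
      obtain ⟨ia, ib⟩ := ih (u := u - 2 ^ (n + 1)) (by omega) (d := (d + 1) / 2) (by omega)
      constructor <;> intro h
      · rw [ia (by omega), succ_of_ge (by omega) (by omega)]
        congr 2
        omega
      · rw [ib (by omega), succ_of_ge (by omega) (by omega)]
        rw [show (u - 2 ^ (n + 1) + 1) / 2 = (u + 1) / 2 - 2 ^ n by omega,
          show (d - 2 ^ (n + 1) + 1) / 2 = (d + 1) / 2 - 2 ^ n by omega]
        omega

lemma comm {n u d : ℕ} (hu : u ≤ 2 ^ n) (hd : d ≤ 2 ^ n) :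
    maxOverlap n u d = maxOverlap n d u := by
  induction n generalizing u d with
  | zero => simp [maxOverlap, min_comm]
  | succ n ih =>
    have h1 : 2 ^ (n + 1) = 2 * 2 ^ n := by ring
    rcases le_total u (2 ^ n) with hu' | hu'
    · rw [succ_of_le _ hu', (succ_right hd hu).1 hu', ih hu' (by omega)]
    · rw [succ_of_ge hu' hd, (succ_right hd hu).2 hu', ih (by omega) (by omega)]

lemma monotone_right (n u : ℕ) : Monotone (maxOverlap n u) := by
  induction n generalizing u with
  | zero => intro d e h; simp only [maxOverlap]; omega
  | succ n ih =>
    intro d e h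
    simp only [maxOverlap]
    split_ifs
    · exact ih _ (by omega)
    · exact add_le_add (by omega) (ih _ (by omega))

lemma add_one_right_le (n u d : ℕ) : maxOverlap n u (d + 1) ≤ maxOverlap n u d + 1 := by
  induction n generalizing u d with
  | zero => simp only [maxOverlap]; omega
  | succ n ih =>
    simp only [maxOverlap]
    rcases Nat.even_or_odd' d with ⟨c, rfl | rfl⟩
    · rw [show (2 * c + 1) / 2 = c by omega, show 2 * c / 2 = c by omega,
        show (2 * c + 1 + 1) / 2 = c + 1 by omega]
      split_ifs
      · omega
      · have := ih (u - 2 ^ n) c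
        omega
    · rw [show (2 * c + 1 + 1) / 2 = c + 1 by omega, show (2 * c + 1) / 2 = c by omega,
        show (2 * c + 1 + 1 + 1) / 2 = c + 1 by omega]
      split_ifs
      · exact ih _ _
      · omega

lemma add_right_le (n u d k : ℕ) : maxOverlap n u (d + k) ≤ maxOverlap n u d + k := by
  induction k with
  | zero => simp
  | succ k ih =>
    have := add_one_right_le n u (d + k)
    rw [← add_assoc]
    omega

lemma mono_left {n u v d : ℕ} (huv : u ≤ v) (hv : v ≤ 2 ^ n) (hd : d ≤ 2 ^ n) :
    maxOverlap n u d ≤ maxOverlap n v d := by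
  rw [comm (huv.trans hv) hd, comm hv hd]
  exact monotone_right n d huv

lemma le_add_sub_left {n u v d : ℕ} (huv : u ≤ v) (hv : v ≤ 2 ^ n) (hd : d ≤ 2 ^ n) :
    maxOverlap n v d ≤ maxOverlap n u d + (v - u) := by
  rw [comm (huv.trans hv) hd, comm hv hd]
  simpa [Nat.add_sub_cancel' huv] using add_right_le n d u (v - u)

lemma le_left {n u d : ℕ} (hu : u ≤ 2 ^ n) (hd : d ≤ 2 ^ n) : maxOverlap n u d ≤ u := by
  simpa [zero_left] using le_add_sub_left (Nat.zero_le u) hu hd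

/-- `maxOverlap` is superadditive from dimension `n` to dimension `n + 1` on oppositely ordered
pairs. -/
def Superadditive (n : ℕ) : Prop :=
  ∀ u₀ u₁ d₀ d₁ : ℕ, u₀ ≤ u₁ → u₁ ≤ 2 ^ n → d₁ ≤ d₀ → d₀ ≤ 2 ^ n →
    maxOverlap n u₀ d₀ + maxOverlap n u₁ d₁ ≤ maxOverlap (n + 1) (u₀ + u₁) (d₀ + d₁)

/-- The superadditivity inequality passes to the next dimension when `u₀` and `u₁` lie on the same
side of the half. -/
lemma superadditive_succ_of_same_side {n : ℕ} (h : Superadditive n) {u₀ u₁ d₀ d₁ : ℕ}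
    (hu : u₀ ≤ u₁) (hu₁ : u₁ ≤ 2 ^ (n + 1)) (hd : d₁ ≤ d₀) (hd₀ : d₀ ≤ 2 ^ (n + 1))
    (hs : u₁ ≤ 2 ^ n ∨ 2 ^ n ≤ u₀) :
    maxOverlap (n + 1) u₀ d₀ + maxOverlap (n + 1) u₁ d₁ ≤
      maxOverlap (n + 1 + 1) (u₀ + u₁) (d₀ + d₁) := by
  have h1 : 2 ^ (n + 1) = 2 * 2 ^ n := by ring
  have h2 : 2 ^ (n + 1 + 1) = 2 * 2 ^ (n + 1) := by ring
  rcases hs with hs | hs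
  · rw [succ_of_le _ hs, succ_of_le _ (hu.trans hs), succ_of_le _ (by omega)]
    refine (h _ _ _ _ hu hs (by omega) (by omega)).trans (monotone_right _ _ (by omega))
  · rw [succ_of_ge hs hd₀, succ_of_ge (hs.trans hu) (hd.trans hd₀),
      succ_of_ge (by omega) (by omega)]
    have key := h (u₀ - 2 ^ n) (u₁ - 2 ^ n) ((d₀ + 1) / 2) ((d₁ + 1) / 2) (by omega) (by omega)
      (by omega) (by omega)
    rw [show u₀ - 2 ^ n + (u₁ - 2 ^ n) = u₀ + u₁ - 2 ^ (n + 1) by omega] at key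
    have hle : maxOverlap (n + 1) (u₀ + u₁ - 2 ^ (n + 1)) ((d₀ + 1) / 2 + (d₁ + 1) / 2) ≤
        maxOverlap (n + 1) (u₀ + u₁ - 2 ^ (n + 1)) ((d₀ + d₁ + 1) / 2) +
          ((d₀ + 1) / 2 + (d₁ + 1) / 2 - (d₀ + d₁ + 1) / 2) := by
      refine le_trans (le_of_eq ?_) (add_right_le _ _ _ _)
      congr 1
      omega
    omega

theorem superadditive (n : ℕ) : Superadditive n := by
  induction n with
  | zero =>
    intro u₀ u₁ d₀ d₁ hu hu₁ hd hd₀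
    norm_num at hu₁ hd₀
    interval_cases u₁ <;> interval_cases u₀ <;> interval_cases d₀ <;> interval_cases d₁ <;>
      simp [maxOverlap]
  | succ n ih =>
    intro u₀ u₁ d₀ d₁ hu hu₁ hd hd₀
    have h1 : 2 ^ (n + 1) = 2 * 2 ^ n := by ring
    have h2 : 2 ^ (n + 1 + 1) = 2 * 2 ^ (n + 1) := by ring
    by_cases hs : u₁ ≤ 2 ^ n ∨ 2 ^ n ≤ u₀
    · exact superadditive_succ_of_same_side ih hu hu₁ hd hd₀ hs
    by_cases ht : d₀ ≤ 2 ^ n ∨ 2 ^ n ≤ d₁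
    · have := superadditive_succ_of_same_side ih hd hd₀ hu hu₁ ht
      rw [comm (hd.trans hd₀) hu₁, comm hd₀ (hu.trans hu₁),
        comm (u := d₁ + d₀) (d := u₁ + u₀) (by omega) (by omega)] at this
      rw [add_comm u₀, add_comm d₀]
      omega
    push Not at hs ht
    rcases n with _ | k
    · have hu0 : u₀ = 0 := by omega
      have hd1 : d₁ = 0 := by omega
      subst hu0 hd1
      rw [zero_left, comm hu₁ (by omega), zero_left]
      exact Nat.zero_le _
    have h3 : 2 ^ (k + 1) = 2 * 2 ^ k := by ring
    have hi (v : ℕ) (hv : v ≤ 2 ^ (k + 1 + 1)) : maxOverlap (k + 1 + 1) v d₀ =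
        v / 2 + maxOverlap (k + 1) ((v + 1) / 2) (d₀ - 2 ^ (k + 1)) :=
      (succ_right hv hd₀).2 ht.1.le
    have lo (v : ℕ) (hv : v ≤ 2 ^ (k + 1 + 1)) : maxOverlap (k + 1 + 1) v d₁ =
        maxOverlap (k + 1) (v / 2) d₁ :=
      (succ_right hv (hd.trans hd₀)).1 ht.2.le
    -- Trade mass between `u₀` and `u₁`, keeping the sum, until one of them is exactly the half.
    have trade (v₀ v₁ : ℕ) (hv : v₀ + v₁ = u₀ + u₁) (h0 : u₀ ≤ v₀) (h01 : v₀ ≤ v₁)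
        (hs' : v₁ = 2 ^ (k + 1) ∨ v₀ = 2 ^ (k + 1)) :
        maxOverlap (k + 1 + 1) u₀ d₀ + maxOverlap (k + 1 + 1) u₁ d₁ ≤
          maxOverlap (k + 1 + 1 + 1) (u₀ + u₁) (d₀ + d₁) := by
      rw [← hv]
      refine le_trans ?_ (superadditive_succ_of_same_side ih h01 (by omega) hd hd₀ (by omega))
      rw [hi u₀ (by omega), hi v₀ (by omega), lo u₁ (by omega), lo v₁ (by omega)]
      have m1 := mono_left (n := k + 1) (u := (u₀ + 1) / 2) (v := (v₀ + 1) / 2)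
        (d := d₀ - 2 ^ (k + 1)) (by omega) (by omega) (by omega)
      have m2 := le_add_sub_left (n := k + 1) (u := v₁ / 2) (v := u₁ / 2) (d := d₁) (by omega)
        (by omega) (by omega)
      omega
    rcases le_total (u₀ + u₁) (2 ^ (k + 1 + 1)) with hc | hc
    · exact trade (u₀ + u₁ - 2 ^ (k + 1)) (2 ^ (k + 1)) (by omega) (by omega) (by omega)
        (Or.inl rfl)
    · exact trade (2 ^ (k + 1)) (u₀ + u₁ - 2 ^ (k + 1)) (by omega) (by omega) (by omega)
        (Or.inr rfl)

/-- Sizes of an up-set and a down-set in dimension `k + 2` with overlap at least `m ≤ 2 ^ k` can be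
replaced by doubled sizes of such a pair in dimension `k`. -/
lemma exists_half {k u d m : ℕ} (hu : u ≤ 2 ^ (k + 2)) (hd : d ≤ 2 ^ (k + 2)) (hm : m ≤ 2 ^ k)
    (h : m ≤ maxOverlap (k + 2) u d) :
    ∃ u' d', u' ≤ 2 ^ k ∧ d' ≤ 2 ^ k ∧ m ≤ maxOverlap k u' d' ∧ 2 * u' + 2 * d' ≤ u + d := by
  have h1 : 2 ^ (k + 1) = 2 * 2 ^ k := by ring
  have h2 : 2 ^ (k + 2) = 2 * 2 ^ (k + 1) := by ring
  have unbalanced (v e : ℕ) (hv : v ≤ 2 ^ (k + 2)) (hv' : 2 ^ (k + 1) ≤ v) (he : e ≤ 2 ^ (k + 1))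
      (h : m ≤ maxOverlap (k + 2) v e) : 2 * 2 ^ k + 2 * m ≤ v + e := by
    rw [(succ_right hv (by omega)).1 he, succ_of_ge (by omega) he] at h
    have := le_left (n := k) (u := v / 2 - 2 ^ k) (d := (e + 1) / 2) (by omega) (by omega)
    omega
  have full (hle : 2 * 2 ^ k + 2 * m ≤ u + d) :
      ∃ u' d', u' ≤ 2 ^ k ∧ d' ≤ 2 ^ k ∧ m ≤ maxOverlap k u' d' ∧ 2 * u' + 2 * d' ≤ u + d :=
    ⟨2 ^ k, m, le_rfl, hm, (full_left k m hm).ge, hle⟩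
  by_cases hsum : 2 ^ (k + 2) ≤ u + d
  · exact full (by omega)
  by_cases hu' : 2 ^ (k + 1) ≤ u
  · exact full (unbalanced u d hu hu' (by omega) h)
  by_cases hd' : 2 ^ (k + 1) ≤ d
  · rw [comm hu hd] at h
    have := unbalanced d u hd hd' (by omega) h
    exact full (by omega)
  rw [succ_of_le _ (by omega), (succ_right (by omega) (by omega)).1 (by omega)] at h
  exact ⟨u / 2, d / 2, by omega, by omega, h, by omega⟩

end maxOverlap

/-! ### Up-sets and down-sets of a power set -/

/-- `U` is an up-set of the power set of `X`. -/
def IsUpIn (X : Finset ℕ) (U : Finset (Finset ℕ)) : Prop :=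
  U ⊆ X.powerset ∧ ∀ A ∈ U, ∀ B, A ⊆ B → B ⊆ X → B ∈ U

/-- `D` is a down-set of the power set of `X`. -/
def IsDownIn (X : Finset ℕ) (D : Finset (Finset ℕ)) : Prop :=
  D ⊆ X.powerset ∧ ∀ A ∈ D, ∀ B, B ⊆ A → B ∈ D

lemma IsUpIn.subset {X : Finset ℕ} {U : Finset (Finset ℕ)} (h : IsUpIn X U) {A : Finset ℕ}
    (hA : A ∈ U) : A ⊆ X := mem_powerset.1 (h.1 hA)

lemma IsDownIn.subset {X : Finset ℕ} {D : Finset (Finset ℕ)} (h : IsDownIn X D) {A : Finset ℕ}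
    (hA : A ∈ D) : A ⊆ X := mem_powerset.1 (h.1 hA)

lemma isUpIn_upClo (X : Finset ℕ) (F : Finset (Finset ℕ)) : IsUpIn X (upClo X F) := by
  refine ⟨filter_subset _ _, fun A hA B hAB hB => ?_⟩
  obtain ⟨-, C, hC, hCA⟩ := mem_filter.1 hA
  exact mem_filter.2 ⟨mem_powerset.2 hB, C, hC, hCA.trans hAB⟩

lemma isDownIn_downClo (X : Finset ℕ) (F : Finset (Finset ℕ)) : IsDownIn X (downClo X F) := by
  refine ⟨filter_subset _ _, fun A hA B hBA => ?_⟩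
  obtain ⟨hAX, C, hC, hAC⟩ := mem_filter.1 hA
  exact mem_filter.2 ⟨mem_powerset.2 (hBA.trans (mem_powerset.1 hAX)), C, hC, hBA.trans hAC⟩

/-- An up-set of size `u` and a down-set of size `d` meet in at most `maxOverlap` sets. -/
theorem card_inter_le_maxOverlap (X : Finset ℕ) {U D : Finset (Finset ℕ)} (hU : IsUpIn X U)
    (hD : IsDownIn X D) : #(U ∩ D) ≤ maxOverlap #X #U #D := by
  induction X using Finset.induction_on generalizing U D with
  | empty =>
    have hU1 : U ⊆ {∅} := by simpa using hU.1
    have hD1 : D ⊆ {∅} := by simpa using hD.1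
    rcases subset_singleton_iff.1 hU1 with rfl | rfl <;>
      rcases subset_singleton_iff.1 hD1 with rfl | rfl <;> simp [maxOverlap]
  | insert a X ha ih =>
    have hU0 : IsUpIn X (U.nonMemberSubfamily a) := by
      refine ⟨fun A hA => ?_, fun A hA B hAB hB => ?_⟩
      · rw [mem_nonMemberSubfamily] at hA
        rw [mem_powerset]
        exact (subset_insert_iff_of_notMem hA.2).1 (hU.subset hA.1)
      · rw [mem_nonMemberSubfamily] at hA ⊢
        exact ⟨hU.2 A hA.1 B hAB (hB.trans (subset_insert _ _)), fun h => ha (hB h)⟩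
    have hU1 : IsUpIn X (U.memberSubfamily a) := by
      refine ⟨fun A hA => ?_, fun A hA B hAB hB => ?_⟩
      · rw [mem_memberSubfamily] at hA
        rw [mem_powerset]
        exact (subset_insert_iff_of_notMem hA.2).1 ((subset_insert _ _).trans (hU.subset hA.1))
      · rw [mem_memberSubfamily] at hA ⊢
        exact ⟨hU.2 _ hA.1 _ (insert_subset_insert _ hAB) (insert_subset_insert _ hB),
          fun h => ha (hB h)⟩
    have hD0 : IsDownIn X (D.nonMemberSubfamily a) := by
      refine ⟨fun A hA => ?_, fun A hA B hBA => ?_⟩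
      · rw [mem_nonMemberSubfamily] at hA
        rw [mem_powerset]
        exact (subset_insert_iff_of_notMem hA.2).1 (hD.subset hA.1)
      · rw [mem_nonMemberSubfamily] at hA ⊢
        exact ⟨hD.2 A hA.1 B hBA, fun h => hA.2 (hBA h)⟩
    have hD1 : IsDownIn X (D.memberSubfamily a) := by
      refine ⟨fun A hA => ?_, fun A hA B hBA => ?_⟩
      · rw [mem_memberSubfamily] at hA
        rw [mem_powerset]
        exact (subset_insert_iff_of_notMem hA.2).1 ((subset_insert _ _).trans (hD.subset hA.1))
      · rw [mem_memberSubfamily] at hA ⊢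
        exact ⟨hD.2 _ hA.1 _ (insert_subset_insert _ hBA), fun h => hA.2 (hBA h)⟩
    have hUs : U.nonMemberSubfamily a ⊆ U.memberSubfamily a := fun A hA => by
      have hAX := hU0.subset hA
      rw [mem_nonMemberSubfamily] at hA
      rw [mem_memberSubfamily]
      exact ⟨hU.2 A hA.1 _ (subset_insert _ _) (insert_subset_insert _ hAX), hA.2⟩
    have hDs : D.memberSubfamily a ⊆ D.nonMemberSubfamily a := fun A hA => by
      rw [mem_memberSubfamily] at hA
      rw [mem_nonMemberSubfamily]
      exact ⟨hD.2 _ hA.1 _ (subset_insert _ _), hA.2⟩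
    have cardle {E : Finset (Finset ℕ)} (hE : E ⊆ X.powerset) : #E ≤ 2 ^ #X := by
      simpa using card_le_card hE
    have key := maxOverlap.superadditive #X _ _ _ _ (card_le_card hUs) (cardle hU1.1)
      (card_le_card hDs) (cardle hD0.1)
    rw [add_comm #(U.nonMemberSubfamily a), card_memberSubfamily_add_card_nonMemberSubfamily,
      add_comm #(D.nonMemberSubfamily a), card_memberSubfamily_add_card_nonMemberSubfamily] at key
    rw [card_insert_of_notMem ha, ← card_memberSubfamily_add_card_nonMemberSubfamily a (U ∩ D),
      memberSubfamily_inter, nonMemberSubfamily_inter]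
    have i0 := ih hU0 hD0
    have i1 := ih hU1 hD1
    omega

lemma IsDownIn.exists_insert {X : Finset ℕ} {D : Finset (Finset ℕ)} (hD : IsDownIn X D)
    (hlt : #D < 2 ^ #X) : ∃ E, IsDownIn X E ∧ D ⊆ E ∧ #E = #D + 1 := by
  have hne : (X.powerset \ D).Nonempty := by
    rw [sdiff_nonempty]
    intro h
    have := card_le_card h
    rw [card_powerset] at this
    omega
  obtain ⟨M, hM⟩ := (X.powerset \ D).exists_minimal hne
  obtain ⟨hMX, hMD⟩ := mem_sdiff.1 hM.1
  refine ⟨insert M D, ⟨insert_subset hMX hD.1, fun A hA B hBA => ?_⟩, subset_insert _ _,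
    card_insert_of_notMem hMD⟩
  rcases mem_insert.1 hA with rfl | hA
  · by_contra hB
    rw [mem_insert, not_or] at hB
    have := hM.2 (mem_sdiff.2 ⟨mem_powerset.2 (hBA.trans (mem_powerset.1 hMX)), hB.2⟩) hBA
    exact hB.1 (hBA.antisymm this)
  · exact mem_insert_of_mem (hD.2 A hA B hBA)

lemma IsDownIn.exists_erase {X : Finset ℕ} {D : Finset (Finset ℕ)} (hD : IsDownIn X D)
    (hne : D.Nonempty) : ∃ E, IsDownIn X E ∧ E ⊆ D ∧ #E + 1 = #D := by
  obtain ⟨M, hM⟩ := D.exists_maximal hne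
  refine ⟨D.erase M, ⟨(erase_subset _ _).trans hD.1, fun A hA B hBA => ?_⟩, erase_subset _ _,
    card_erase_add_one hM.1⟩
  rw [mem_erase] at hA ⊢
  refine ⟨?_, hD.2 A hA.2 B hBA⟩
  rintro rfl
  exact hA.1 ((hM.2 hA.2 hBA).antisymm hBA)

/-- The family on `insert a X` whose sections without and with `a` are `A₀` and `A₁`. -/
def glue (a : ℕ) (A₀ A₁ : Finset (Finset ℕ)) : Finset (Finset ℕ) := A₀ ∪ A₁.image (insert a)

lemma mem_glue {a : ℕ} {X : Finset ℕ} (ha : a ∉ X) {A₀ A₁ : Finset (Finset ℕ)}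
    (h₀ : A₀ ⊆ X.powerset) (h₁ : A₁ ⊆ X.powerset) {S : Finset ℕ} :
    S ∈ glue a A₀ A₁ ↔ a ∉ S ∧ S ∈ A₀ ∨ a ∈ S ∧ S.erase a ∈ A₁ := by
  rw [glue, mem_union, mem_image]
  refine or_congr ⟨fun h => ⟨fun h' => ha (mem_powerset.1 (h₀ h) h'), h⟩, And.right⟩ ⟨?_, ?_⟩
  · rintro ⟨T, hT, rfl⟩
    refine ⟨mem_insert_self _ _, ?_⟩
    rwa [erase_insert fun h' => ha (mem_powerset.1 (h₁ hT) h')]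
  · rintro ⟨h, h'⟩
    exact ⟨_, h', insert_erase h⟩

lemma card_glue {a : ℕ} {X : Finset ℕ} (ha : a ∉ X) {A₀ A₁ : Finset (Finset ℕ)}
    (h₀ : A₀ ⊆ X.powerset) (h₁ : A₁ ⊆ X.powerset) : #(glue a A₀ A₁) = #A₀ + #A₁ := by
  rw [glue, card_union_of_disjoint, card_image_of_injOn]
  · intro S hS T hT h
    have hS' : a ∉ S := fun h' => ha (mem_powerset.1 (h₁ hS) h')
    have hT' : a ∉ T := fun h' => ha (mem_powerset.1 (h₁ hT) h')
    rw [← erase_insert hS', ← erase_insert hT']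
    exact congrArg (fun R => R.erase a) h
  · rw [disjoint_left]
    rintro S hS hS'
    obtain ⟨T, -, rfl⟩ := mem_image.1 hS'
    exact ha (mem_powerset.1 (h₀ hS) (mem_insert_self _ _))

lemma glue_subset {a : ℕ} {X : Finset ℕ} {A₀ A₁ : Finset (Finset ℕ)}
    (h₀ : A₀ ⊆ X.powerset) (h₁ : A₁ ⊆ X.powerset) : glue a A₀ A₁ ⊆ (insert a X).powerset := by
  refine union_subset (h₀.trans (powerset_mono.2 (subset_insert _ _))) fun S hS => ?_
  obtain ⟨T, hT, rfl⟩ := mem_image.1 hS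
  exact mem_powerset.2 (insert_subset_insert _ (mem_powerset.1 (h₁ hT)))

lemma IsUpIn.glue {a : ℕ} {X : Finset ℕ} (ha : a ∉ X) {U₀ U₁ : Finset (Finset ℕ)}
    (h₀ : IsUpIn X U₀) (h₁ : IsUpIn X U₁) (h : U₀ ⊆ U₁) :
    IsUpIn (insert a X) (glue a U₀ U₁) := by
  refine ⟨glue_subset h₀.1 h₁.1, fun A hA B hAB hB => ?_⟩
  rw [mem_glue ha h₀.1 h₁.1] at hA ⊢
  have hB' : B.erase a ⊆ X := subset_insert_iff.1 hB
  by_cases haB : a ∈ B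
  · refine Or.inr ⟨haB, ?_⟩
    rcases hA with ⟨haA, hA⟩ | ⟨-, hA⟩
    · exact h₁.2 A (h hA) _ (subset_erase.2 ⟨hAB, haA⟩) hB'
    · exact h₁.2 _ hA _ (erase_subset_erase _ hAB) hB'
  · rcases hA with ⟨haA, hA⟩ | ⟨haA, -⟩
    · refine Or.inl ⟨haB, h₀.2 A hA B hAB ?_⟩
      rwa [erase_eq_of_notMem haB] at hB'
    · exact absurd (hAB haA) haB

lemma IsDownIn.glue {a : ℕ} {X : Finset ℕ} (ha : a ∉ X) {D₀ D₁ : Finset (Finset ℕ)}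
    (h₀ : IsDownIn X D₀) (h₁ : IsDownIn X D₁) (h : D₁ ⊆ D₀) :
    IsDownIn (insert a X) (glue a D₀ D₁) := by
  refine ⟨glue_subset h₀.1 h₁.1, fun A hA B hBA => ?_⟩
  rw [mem_glue ha h₀.1 h₁.1] at hA ⊢
  by_cases haB : a ∈ B
  · rcases hA with ⟨haA, -⟩ | ⟨-, hA⟩
    · exact absurd (hBA haB) haA
    · exact Or.inr ⟨haB, h₁.2 _ hA _ (erase_subset_erase _ hBA)⟩
  · refine Or.inl ⟨haB, ?_⟩
    rcases hA with ⟨-, hA⟩ | ⟨-, hA⟩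
    · exact h₀.2 A hA B hBA
    · exact h₀.2 _ (h hA) B (subset_erase.2 ⟨hBA, haB⟩)

lemma glue_inter_subset {a : ℕ} (A₀ A₁ B₀ B₁ : Finset (Finset ℕ)) :
    glue a (A₀ ∩ B₀) (A₁ ∩ B₁) ⊆ glue a A₀ A₁ ∩ glue a B₀ B₁ :=
  subset_inter (union_subset_union inter_subset_left (image_subset_image inter_subset_left))
    (union_subset_union inter_subset_right (image_subset_image inter_subset_right))

lemma isUpIn_empty (X : Finset ℕ) : IsUpIn X ∅ := by simp [IsUpIn]

lemma isUpIn_powerset (X : Finset ℕ) : IsUpIn X X.powerset :=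
  ⟨Subset.rfl, fun _ _ _ _ h => mem_powerset.2 h⟩

/-- The bound `maxOverlap` is attained. -/
theorem exists_maxOverlap_le_card_inter (X : Finset ℕ) {u d : ℕ} (hu : u ≤ 2 ^ #X)
    (hd : d ≤ 2 ^ #X) :
    ∃ U D, IsUpIn X U ∧ IsDownIn X D ∧ #U = u ∧ #D = d ∧ maxOverlap #X u d ≤ #(U ∩ D) := by
  induction X using Finset.induction_on generalizing u d with
  | empty =>
    norm_num at hu hd
    have aux (t : ℕ) (ht : t ≤ 1) :
        ∃ E, IsUpIn ∅ E ∧ IsDownIn ∅ E ∧ #E = t ∧ (t = 1 → E = {∅}) := by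
      interval_cases t
      · exact ⟨∅, by simp [IsUpIn, IsDownIn]⟩
      · exact ⟨{∅}, by simp [IsUpIn, IsDownIn]⟩
    obtain ⟨U, hU, -, hUc, hU1⟩ := aux u hu
    obtain ⟨D, -, hD, hDc, hD1⟩ := aux d hd
    refine ⟨U, D, hU, hD, hUc, hDc, ?_⟩
    interval_cases u <;> interval_cases d <;> simp_all [maxOverlap]
  | insert a X ha ih =>
    rw [card_insert_of_notMem ha] at hu hd ⊢
    have h2 : 2 ^ (#X + 1) = 2 * 2 ^ #X := by ring
    rcases le_total u (2 ^ #X) with hu' | hu'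
    · obtain ⟨U, D, hU, hD, hUc, hDc, hUD⟩ := ih (u := u) (d := d / 2) hu' (by omega)
      obtain ⟨E, hE, hDE, hEc⟩ : ∃ E, IsDownIn X E ∧ D ⊆ E ∧ #E = (d + 1) / 2 := by
        rcases Nat.even_or_odd' d with ⟨c, rfl | rfl⟩
        · exact ⟨D, hD, Subset.rfl, by omega⟩
        · obtain ⟨E, hE, hDE, hEc⟩ := hD.exists_insert (by omega)
          exact ⟨E, hE, hDE, by omega⟩
      refine ⟨_, _, (isUpIn_empty X).glue ha hU (empty_subset _), hE.glue ha hD hDE, ?_, ?_, ?_⟩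
      · rw [card_glue ha (isUpIn_empty X).1 hU.1, card_empty, hUc, zero_add]
      · rw [card_glue ha hE.1 hD.1]
        omega
      · refine le_trans ?_ (card_le_card (glue_inter_subset _ _ _ _))
        rw [card_glue ha (inter_subset_right.trans hE.1) (inter_subset_right.trans hD.1),
          maxOverlap.succ_of_le _ hu']
        omega
    · obtain ⟨U, D, hU, hD, hUc, hDc, hUD⟩ :=
        ih (u := u - 2 ^ #X) (d := (d + 1) / 2) (by omega) (by omega)
      obtain ⟨E, hE, hED, hEc⟩ : ∃ E, IsDownIn X E ∧ E ⊆ D ∧ #E = d / 2 := by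
        rcases Nat.even_or_odd' d with ⟨c, rfl | rfl⟩
        · exact ⟨D, hD, Subset.rfl, by omega⟩
        · obtain ⟨E, hE, hED, hEc⟩ := hD.exists_erase (card_pos.1 (by omega))
          exact ⟨E, hE, hED, by omega⟩
      refine ⟨_, _, hU.glue ha (isUpIn_powerset X) hU.1, hD.glue ha hE hED, ?_, ?_, ?_⟩
      · rw [card_glue ha hU.1 Subset.rfl, card_powerset]
        omega
      · rw [card_glue ha hD.1 hE.1]
        omega
      · refine le_trans ?_ (card_le_card (glue_inter_subset _ _ _ _))
        rw [card_glue ha (inter_subset_right.trans hD.1) (inter_subset_right.trans hE.1),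
          maxOverlap.succ_of_ge hu' hd, inter_eq_right.2 hE.1]
        omega

/-! ### Convex families -/

lemma isConvex_of_ordConnected {X : Finset ℕ} {F : Finset (Finset ℕ)} (hF : F ⊆ X.powerset)
    (h : (F : Set (Finset ℕ)).OrdConnected) : IsConvex X F := by
  ext S
  simp only [upClo, downClo, mem_inter, mem_filter]
  constructor
  · rintro ⟨⟨-, A, hA, hAS⟩, -, C, hC, hSC⟩
    exact h.out hA hC ⟨hAS, hSC⟩
  · exact fun hS => ⟨⟨hF hS, S, hS, Subset.rfl⟩, hF hS, S, hS, Subset.rfl⟩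

/-- An order-connected family contains order-connected families of every smaller size. -/
lemma exists_ordConnected_subset_card_eq {H : Finset (Finset ℕ)}
    (hH : (H : Set (Finset ℕ)).OrdConnected) {m : ℕ} (hm : m ≤ #H) :
    ∃ F ⊆ H, #F = m ∧ (F : Set (Finset ℕ)).OrdConnected := by
  induction hm using Nat.decreasingInduction with
  | self => exact ⟨H, Subset.rfl, rfl, hH⟩
  | of_succ k hk ih =>
    obtain ⟨F, hFH, hFc, hF⟩ := ih
    obtain ⟨M, hM⟩ := F.exists_minimal (card_pos.1 (by omega))
    refine ⟨F.erase M, (erase_subset _ _).trans hFH, by rw [card_erase_of_mem hM.1]; omega,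
      ⟨fun A hA C hC B hB => ?_⟩⟩
    simp only [coe_erase, Set.mem_sdiff, mem_coe, Set.mem_singleton_iff] at hA hC ⊢
    refine ⟨hF.out hA.1 hC.1 hB, ?_⟩
    rintro rfl
    exact hA.2 (hB.1.antisymm (hM.2 hA.1 hB.1))

lemma card_udClo_add {X : Finset ℕ} {F : Finset (Finset ℕ)} (h : IsConvex X F) :
    #(udClo X F) + #F = #(upClo X F) + #(downClo X F) := by
  have := card_union_add_card_inter (upClo X F) (downClo X F)
  rwa [h] at this

lemma ordConnected_upClo_inter_downClo (X : Finset ℕ) (F : Finset (Finset ℕ)) :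
    ((upClo X F ∩ downClo X F : Finset (Finset ℕ)) : Set (Finset ℕ)).OrdConnected := by
  refine ⟨fun A hA C hC B hB => ?_⟩
  rw [mem_coe, mem_inter] at hA hC ⊢
  exact ⟨(isUpIn_upClo X F).2 A hA.1 B hB.1 (hB.2.trans ((isUpIn_upClo X F).subset hC.1)),
    (isDownIn_downClo X F).2 C hC.2 B hB.2⟩

/-- Every family can be replaced by a convex one of the same size without enlarging `𝓕↕`. -/
lemma exists_isConvex_card_eq {X : Finset ℕ} {F : Finset (Finset ℕ)} (hF : F ⊆ X.powerset) :
    ∃ G ⊆ X.powerset, #G = #F ∧ IsConvex X G ∧ udClo X G ⊆ udClo X F := by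
  have hsub : F ⊆ upClo X F ∩ downClo X F := fun S hS =>
    mem_inter.2 ⟨mem_filter.2 ⟨hF hS, S, hS, Subset.rfl⟩, mem_filter.2 ⟨hF hS, S, hS, Subset.rfl⟩⟩
  obtain ⟨G, hGH, hGc, hG⟩ := exists_ordConnected_subset_card_eq
    (ordConnected_upClo_inter_downClo X F) (card_le_card hsub)
  have hGX : G ⊆ X.powerset := fun S hS => (isUpIn_upClo X F).1 (mem_inter.1 (hGH hS)).1
  refine ⟨G, hGX, hGc, isConvex_of_ordConnected hGX hG, union_subset_union ?_ ?_⟩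
  · intro S hS
    obtain ⟨hSX, A, hA, hAS⟩ := mem_filter.1 hS
    exact (isUpIn_upClo X F).2 A (mem_inter.1 (hGH hA)).1 S hAS (mem_powerset.1 hSX)
  · intro S hS
    obtain ⟨-, A, hA, hSA⟩ := mem_filter.1 hS
    exact (isDownIn_downClo X F).2 A (mem_inter.1 (hGH hA)).2 S hSA

/-! ### Lifting a pair to two more dimensions -/

lemma ordConnected_image_insert {a : ℕ} {Y : Finset ℕ} (ha : a ∉ Y) {U D : Finset (Finset ℕ)}
    (hU : IsUpIn Y U) (hD : IsDownIn Y D) :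
    (((U ∩ D).image (insert a) : Finset (Finset ℕ)) : Set (Finset ℕ)).OrdConnected := by
  refine ⟨fun A hA C hC B hB => ?_⟩
  rw [mem_coe, mem_image] at hA hC ⊢
  obtain ⟨A, hA, rfl⟩ := hA
  obtain ⟨C, hC, rfl⟩ := hC
  rw [mem_inter] at hA hC
  have haB : a ∈ B := hB.1 (mem_insert_self _ _)
  have hAB : A ⊆ B.erase a :=
    subset_erase.2 ⟨(subset_insert _ _).trans hB.1, fun h => ha (hU.subset hA.1 h)⟩
  have hBC : B.erase a ⊆ C := subset_insert_iff.1 hB.2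
  exact ⟨B.erase a, mem_inter.2 ⟨hU.2 A hA.1 _ hAB (hBC.trans (hD.subset hC.2)),
    hD.2 C hC.2 _ hBC⟩, insert_erase haB⟩

lemma card_upClo_le {a b : ℕ} {Y : Finset ℕ} (ha : a ∉ Y) (hb : b ∉ Y)
    {U F : Finset (Finset ℕ)} (hU : IsUpIn Y U) (hF : F ⊆ U.image (insert a)) :
    #(upClo (insert a (insert b Y)) F) ≤ 2 * #U := by
  have hsub : upClo (insert a (insert b Y)) F ⊆ (glue b U U).image (insert a) := by
    intro S hS
    obtain ⟨hSX, A, hA, hAS⟩ := mem_filter.1 hS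
    obtain ⟨B, hB, rfl⟩ := mem_image.1 (hF hA)
    refine mem_image.2 ⟨S.erase a, (hU.glue hb hU Subset.rfl).2 B ?_ _ ?_ ?_,
      insert_erase (hAS (mem_insert_self _ _))⟩
    · exact mem_union_left _ hB
    · exact subset_erase.2 ⟨(subset_insert _ _).trans hAS, fun h => ha (hU.subset hB h)⟩
    · exact subset_insert_iff.1 (mem_powerset.1 hSX)
  refine (card_le_card hsub).trans (card_image_le.trans ?_)
  rw [card_glue hb hU.1 hU.1, two_mul]

lemma card_downClo_le {a : ℕ} (X : Finset ℕ) {Y : Finset ℕ} (ha : a ∉ Y)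
    {D F : Finset (Finset ℕ)} (hD : IsDownIn Y D) (hF : F ⊆ D.image (insert a)) :
    #(downClo X F) ≤ 2 * #D := by
  have hsub : downClo X F ⊆ glue a D D := by
    intro S hS
    obtain ⟨-, A, hA, hSA⟩ := mem_filter.1 hS
    exact (hD.glue ha hD Subset.rfl).2 A (mem_union_right _ (hF hA)) S hSA
  refine (card_le_card hsub).trans ?_
  rw [card_glue ha hD.1 hD.1, two_mul]

/-- Any family of at most `2 ^ |Y|` subsets of `Y ∪ {a, b}` is dominated by a convex family of the
same size all of whose members contain `a` but not `b`. -/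
theorem exists_isConvex_subset_card_udClo_le {a b : ℕ} {Y : Finset ℕ} (ha : a ∉ Y) (hb : b ∉ Y)
    (hab : a ≠ b) {F : Finset (Finset ℕ)} (hF : F ⊆ (insert a (insert b Y)).powerset)
    (hm : #F ≤ 2 ^ #Y) :
    ∃ G ⊆ Y.powerset.image (insert a), #G = #F ∧ IsConvex (insert a (insert b Y)) G ∧
      #(udClo (insert a (insert b Y)) G) ≤ #(udClo (insert a (insert b Y)) F) := by
  have hX : #(insert a (insert b Y)) = #Y + 2 := by
    rw [card_insert_of_notMem (by simp [hab, ha]), card_insert_of_notMem hb]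
  obtain ⟨F', hF'X, hF'c, hF', hle⟩ := exists_isConvex_card_eq hF
  have hYX : Y.powerset.image (insert a) ⊆ (insert a (insert b Y)).powerset := by
    intro S hS
    obtain ⟨T, hT, rfl⟩ := mem_image.1 hS
    exact mem_powerset.2 (insert_subset_insert _ ((mem_powerset.1 hT).trans (subset_insert _ _)))
  have cardle {E : Finset (Finset ℕ)} (hE : E ⊆ (insert a (insert b Y)).powerset) :
      #E ≤ 2 ^ (#Y + 2) := by
    simpa [hX] using card_le_card hE
  have hbound := card_inter_le_maxOverlap _ (isUpIn_upClo (insert a (insert b Y)) F')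
    (isDownIn_downClo (insert a (insert b Y)) F')
  rw [hF', hX, hF'c] at hbound
  obtain ⟨u, d, hu, hd, hmud, hsum⟩ := maxOverlap.exists_half (cardle (isUpIn_upClo _ F').1)
    (cardle (isDownIn_downClo _ F').1) hm hbound
  obtain ⟨U, D, hU, hD, hUc, hDc, hUD⟩ := exists_maxOverlap_le_card_inter Y hu hd
  have hinj : Set.InjOn (insert a) ((U ∩ D : Finset (Finset ℕ)) : Set (Finset ℕ)) := by
    intro S hS T hT h
    rw [mem_coe, mem_inter] at hS hT
    rw [← erase_insert fun h' => ha (hU.subset hS.1 h'),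
      ← erase_insert fun h' => ha (hU.subset hT.1 h')]
    exact congrArg (fun R => R.erase a) h
  obtain ⟨G, hGH, hGc, hG⟩ := exists_ordConnected_subset_card_eq
    (ordConnected_image_insert ha hU hD) (m := #F) (by
      rw [card_image_of_injOn hinj]
      exact hmud.trans hUD)
  have hGY : G ⊆ Y.powerset.image (insert a) :=
    hGH.trans (image_subset_image (inter_subset_left.trans hU.1))
  have hGconv := isConvex_of_ordConnected (hGY.trans hYX) hG
  refine ⟨G, hGY, hGc, hGconv, le_trans ?_ (card_le_card hle)⟩
  have e1 := card_udClo_add hF'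
  have e2 := card_udClo_add hGconv
  have e3 := card_upClo_le ha hb hU (hGH.trans (image_subset_image inter_subset_left))
  have e4 := card_downClo_le (insert a (insert b Y)) ha hD
    (hGH.trans (image_subset_image inter_subset_right))
  omega

/-- Lemma 13: for `n ≥ 2` and `m ≤ 2^(n-2)` there is an `(n,m)`-witness family `𝓕` that
is convex and satisfies `𝓕 ⊆ 𝒞 = {A ⊆ [n] : {1} ⊆ A ⊆ [n-1]}`. -/
theorem stmt12 (n m : ℕ) (hn : 2 ≤ n) (hm : m ≤ 2 ^ (n - 2)) :
    ∃ F : Finset (Finset ℕ), F ⊆ (groundSet n).powerset ∧ F.card = m ∧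
      (udClo (groundSet n) F).card = Phi n m ∧ IsConvex (groundSet n) F ∧
      F ⊆ (groundSet n).powerset.filter (fun A => 1 ∈ A ∧ A ⊆ groundSet (n - 1)) := by
  have hYins : groundSet n = insert 1 (insert n (Finset.Icc 2 (n - 1))) := by
    ext i
    simp only [groundSet, mem_insert, Finset.mem_Icc]
    omega
  have hYcard : #(Finset.Icc 2 (n - 1)) = n - 2 := by
    rw [Nat.card_Icc]
    omega
  have hne : {k | ∃ F : Finset (Finset ℕ), F ⊆ (groundSet n).powerset ∧ F.card = m ∧
      (udClo (groundSet n) F).card = k}.Nonempty := by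
    have hle : m ≤ #(groundSet n).powerset := by
      rw [card_powerset, groundSet, Nat.card_Icc]
      exact hm.trans (Nat.pow_le_pow_right two_pos (by omega))
    obtain ⟨F, hF, hFc⟩ := exists_subset_card_eq hle
    exact ⟨_, F, hF, hFc, rfl⟩
  obtain ⟨F, hF, hFc, hFPhi⟩ := Nat.sInf_mem hne
  obtain ⟨G, hGY, hGc, hG, hle⟩ := exists_isConvex_subset_card_udClo_le (a := 1) (b := n)
    (Y := Finset.Icc 2 (n - 1)) (F := F) (by simp) (by simp only [Finset.mem_Icc]; omega)
    (by omega) (by rwa [← hYins])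
    (by rwa [hFc, hYcard])
  rw [← hYins] at hG hle
  have hGC : G ⊆ (groundSet n).powerset.filter (fun A => 1 ∈ A ∧ A ⊆ groundSet (n - 1)) := by
    intro S hS
    obtain ⟨T, hT, rfl⟩ := mem_image.1 (hGY hS)
    rw [mem_powerset] at hT
    have hsub : insert 1 T ⊆ groundSet (n - 1) := by
      refine insert_subset (by simp only [groundSet, Finset.mem_Icc]; omega) (hT.trans ?_)
      exact Icc_subset_Icc_left one_le_two
    refine mem_filter.2 ⟨mem_powerset.2 (hsub.trans ?_), mem_insert_self _ _, hsub⟩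
    exact Icc_subset_Icc_right (Nat.sub_le n 1)
  have hGX := hGC.trans (filter_subset _ _)
  exact ⟨G, hGX, hGc.trans hFc, le_antisymm (hle.trans hFPhi.le)
    (Nat.sInf_le ⟨G, hGX, hGc.trans hFc, rfl⟩), hG, hGC⟩
end
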